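/- arXiv:1710.10018 — 2 statements merged into one kernel-verified Lean document; each statement's English description precedes it below -/
import Mathlib

section
/- Let (R, m, k) be a Cohen–Macaulay local ring of dimension d and X a resolving subcategory of finitely generated R-modules of finite radius. If some syzygy Ω^n k of the residue field belongs to X, then every module in X is maximal Cohen–Macaulay. -/
open CategoryTheory

noncomputable section

namespace Paper

variable (R : Type) [CommRing R]

/-- finitely generated projective module (object of `add R`) -/
def FGProj (M : ModuleCat.{0} R) : Prop := Module.Finite R M ∧ Module.Projective R M

/-- a short exact sequence `0 → L → M → N → 0` -/
def SES {L M N : ModuleCat.{0} R} (f : L →ₗ[R] M) (g : M →ₗ[R] N) : Prop :=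
  Function.Injective f ∧ Function.Surjective g ∧ LinearMap.ker g = LinearMap.range f

/-- `N` is a first syzygy of `M`: kernel of a surjection from a f.g. projective onto `M`. -/
def IsSyzygy (N M : ModuleCat.{0} R) : Prop :=
  ∃ (P : ModuleCat.{0} R) (f : P →ₗ[R] M), FGProj R P ∧ Function.Surjective f ∧
    Nonempty (N ≃ₗ[R] LinearMap.ker f)

/-- `N` is an `n`-th syzygy of `M` -/
def IsNthSyzygy : ℕ → ModuleCat.{0} R → ModuleCat.{0} R → Prop
  | 0, N, M => Nonempty (N ≃ₗ[R] M)
  | (n+1), N, M => ∃ K : ModuleCat.{0} R, IsNthSyzygy n K M ∧ IsSyzygy R N K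

/-- `f : M → P` is a left `add R`-approximation -/
def IsLeftApprox {M P : ModuleCat.{0} R} (f : M →ₗ[R] P) : Prop :=
  FGProj R P ∧ ∀ (Q : ModuleCat.{0} R), FGProj R Q → ∀ g : M →ₗ[R] Q,
    ∃ h : P →ₗ[R] Q, h.comp f = g

/-- `N` is a first cosyzygy of `M`: cokernel of a left `add R`-approximation. -/
def IsCosyzygy (N M : ModuleCat.{0} R) : Prop :=
  ∃ (P : ModuleCat.{0} R) (f : M →ₗ[R] P), IsLeftApprox R f ∧
    Nonempty (N ≃ₗ[R] (P ⧸ LinearMap.range f))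

/-- `N` is an `n`-th cosyzygy of `M` -/
def IsNthCosyzygy : ℕ → ModuleCat.{0} R → ModuleCat.{0} R → Prop
  | 0, N, M => Nonempty (N ≃ₗ[R] M)
  | (n+1), N, M => ∃ K : ModuleCat.{0} R, IsNthCosyzygy n K M ∧ IsCosyzygy R N K

/-- `T` is an (Auslander) transpose of `M` -/
def IsTranspose (T M : ModuleCat.{0} R) : Prop :=
  ∃ (P₁ P₀ : ModuleCat.{0} R) (d : P₁ →ₗ[R] P₀) (p : P₀ →ₗ[R] M),
    FGProj R P₁ ∧ FGProj R P₀ ∧ Function.Surjective p ∧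
    LinearMap.ker p = LinearMap.range d ∧
    Nonempty (T ≃ₗ[R] ((Module.Dual R P₁) ⧸ LinearMap.range d.dualMap))

/-- stably isomorphic: `M ⊕ P ≅ N ⊕ Q` with `P`, `Q` f.g. projective -/
def StablyIso (M N : ModuleCat.{0} R) : Prop :=
  ∃ P Q : ModuleCat.{0} R, FGProj R P ∧ FGProj R Q ∧
    Nonempty ((M × P) ≃ₗ[R] (N × Q))

/-- resolving subcategory of `mod R` -/
structure Resolving (X : ModuleCat.{0} R → Prop) : Prop where
  fg : ∀ M, X M → Module.Finite R M
  proj : ∀ M : ModuleCat.{0} R, FGProj R M → X M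
  summand : ∀ M N N' : ModuleCat.{0} R, X M → Nonempty (M ≃ₗ[R] N × N') → X N
  extension : ∀ (L M N : ModuleCat.{0} R) (f : L →ₗ[R] M) (g : M →ₗ[R] N),
      SES R f g → X L → X N → X M
  ker_epi : ∀ (L M N : ModuleCat.{0} R) (f : L →ₗ[R] M) (g : M →ₗ[R] N),
      SES R f g → X M → X N → X L

/-- `Ext^i_R(M, N) = 0` -/
def ExtVanish (M N : ModuleCat.{0} R) (i : ℕ) : Prop :=
  Subsingleton (((Ext R (ModuleCat.{0} R) i).obj (Opposite.op M)).obj N)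

/-- totally reflexive (Gorenstein dimension zero) module -/
def TotallyReflexive (M : ModuleCat.{0} R) : Prop :=
  Function.Bijective (Module.Dual.eval R M) ∧
  ∀ i : ℕ, 0 < i → ExtVanish R M (ModuleCat.of R R) i ∧
    ExtVanish R (ModuleCat.of R (Module.Dual R M)) (ModuleCat.of R R) i

/-- `M` has finite projective dimension -/
def FiniteProjDim (M : ModuleCat.{0} R) : Prop :=
  ∃ (n : ℕ) (N : ModuleCat.{0} R), IsNthSyzygy R n N M ∧ FGProj R N

/-- additive closure of a family of modules -/
def AddClosure (S : ModuleCat.{0} R → Prop) (M : ModuleCat.{0} R) : Prop :=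
  ∃ (k : ℕ) (f : Fin k → ModuleCat.{0} R) (N : ModuleCat.{0} R),
    (∀ i, S (f i)) ∧ Nonempty ((M × N) ≃ₗ[R] ((i : Fin k) → f i))

/-- the operation `[−]`: `add` closure of `R` and all syzygies of modules of `Y` -/
def Bracket (Y : ModuleCat.{0} R → Prop) : ModuleCat.{0} R → Prop :=
  AddClosure R (fun N => FGProj R N ∨ ∃ (M : ModuleCat.{0} R) (i : ℕ), Y M ∧ IsNthSyzygy R i N M)

/-- `Y ∘ Z`: extensions of a module of `Z` by a module of `Y` -/
def ExtOf (Y Z : ModuleCat.{0} R → Prop) (M : ModuleCat.{0} R) : Prop :=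
  ∃ (A B : ModuleCat.{0} R) (f : A →ₗ[R] M) (g : M →ₗ[R] B), Y A ∧ Z B ∧ SES R f g

/-- the ball `[C]_n` of radius `n` centered at `C` -/
def Ball (C : ModuleCat.{0} R) : ℕ → ModuleCat.{0} R → Prop
  | 0 => fun _ => False
  | 1 => Bracket R (fun M => Nonempty (M ≃ₗ[R] C))
  | (n+2) => Bracket R (ExtOf R (Ball C (n+1)) (Bracket R (fun M => Nonempty (M ≃ₗ[R] C))))

/-- `X` has finite radius: `X ⊆ [C]_{n+1}` for some `C ∈ X`. -/
def FiniteRadius (X : ModuleCat.{0} R → Prop) : Prop :=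
  ∃ (C : ModuleCat.{0} R) (n : ℕ), X C ∧ ∀ M, X M → Ball R C (n + 1) M

/-- `depth_A M ≥ n`: there is a weakly `M`-regular sequence of length `n` in the maximal ideal -/
def DepthGE (A : Type) [CommRing A] [IsLocalRing A]
    (M : Type) [AddCommGroup M] [Module A M] (n : ℕ) : Prop :=
  ∃ rs : List A, rs.length = n ∧ (∀ x ∈ rs, x ∈ IsLocalRing.maximalIdeal A) ∧
    RingTheory.Sequence.IsWeaklyRegular M rs

/-- `M` is free at the prime `p` -/
def FreeAt (M : ModuleCat.{0} R) (p : PrimeSpectrum R) : Prop :=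
  Module.Free (Localization.AtPrime p.asIdeal) (LocalizedModule p.asIdeal.primeCompl M)

/-- locally free on the punctured spectrum of a local ring -/
def LocFreeOnPunctured [IsLocalRing R] (M : ModuleCat.{0} R) : Prop :=
  ∀ p : PrimeSpectrum R, p.asIdeal ≠ IsLocalRing.maximalIdeal R → FreeAt R M p

/-- a Gorenstein local ring: `R` has finite injective dimension over itself -/
def Gorenstein : Prop :=
  ∃ n : ℕ, ∀ i : ℕ, n < i → ∀ M : ModuleCat.{0} R, ExtVanish R M (ModuleCat.of R R) i

/-- the annihilator of the `i`-th local cohomology module `H^i_I(M)` -/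
def aa (I : Ideal R) (i : ℕ) (M : ModuleCat.{0} R) : Ideal R :=
  Module.annihilator R ((localCohomology I i).obj M)

/-- an Ulrich module over a CM local ring of dimension `d` -/
def Ulrich [IsLocalRing R] (d : ℕ) (U : ModuleCat.{0} R) : Prop :=
  Module.Finite R U ∧ DepthGE R U d ∧ ¬ Subsingleton U ∧
  ∃ xs : List R, xs.length = d ∧ (∀ x ∈ xs, x ∈ IsLocalRing.maximalIdeal R) ∧
    RingTheory.Sequence.IsWeaklyRegular U xs ∧
    (IsLocalRing.maximalIdeal R) • (⊤ : Submodule R U) = Ideal.ofList xs • ⊤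

end Paper

open Paper


namespace Pf

set_option linter.unusedSectionVars false

variable {R : Type} [CommRing R]

lemma elim_add {A B M : Type} [AddCommGroup M] (a a' : A → M) (b b' : B → M) :
    Sum.elim (a + a') (b + b') = Sum.elim a b + Sum.elim a' b' := by
  funext s; rcases s with s | s <;> rfl

lemma elim_smul {A B M : Type} [AddCommGroup M] [Module R M] (c : R) (a : A → M) (b : B → M) :
    Sum.elim (c • a) (c • b) = c • Sum.elim a b := by
  funext s; rcases s with s | s <;> rfl

/-- index types of the Koszul complex -/
def S : List R → ℕ → Type
  | [], 0 => Unit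
  | [], _ + 1 => Empty
  | _ :: l, 0 => S l 0
  | _ :: l, i + 1 => S l (i + 1) ⊕ S l i

/-- the Koszul differential `K_{i+1}(M) → K_i(M)` -/
def dK (M : Type) [AddCommGroup M] [Module R M] :
    (l : List R) → (i : ℕ) → (S l (i + 1) → M) →ₗ[R] (S l i → M)
  | [], _ => 0
  | x :: l, 0 =>
    { toFun := fun f => dK M l 0 (fun s => f (Sum.inl s)) + x • (fun s => f (Sum.inr s))
      map_add' := by
        intro f g
        have : dK M l 0 (fun s => (f + g) (Sum.inl s)) =
          dK M l 0 (fun s => f (Sum.inl s)) + dK M l 0 (fun s => g (Sum.inl s)) := by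
            rw [← map_add]; rfl
        rw [this]
        have h2 : (fun s => (f + g) (Sum.inr s)) =
          (fun s => f (Sum.inr s)) + (fun s => g (Sum.inr s)) := rfl
        rw [h2, smul_add]; abel
      map_smul' := by
        intro c f
        have : dK M l 0 (fun s => (c • f) (Sum.inl s)) =
          c • dK M l 0 (fun s => f (Sum.inl s)) := by
            rw [← map_smul]; rfl
        rw [this]
        have h2 : (fun s => (c • f) (Sum.inr s)) = c • (fun s => f (Sum.inr s)) := rfl
        rw [h2, smul_comm x c, RingHom.id_apply]
        exact (smul_add (A := S l 0 → M) c _ _).symm }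
  | x :: l, i + 1 =>
    { toFun := fun f => Sum.elim
        (dK M l (i + 1) (fun s => f (Sum.inl s)) + x • (fun s => f (Sum.inr s)))
        (-(dK M l i (fun s => f (Sum.inr s))))
      map_add' := by
        intro f g
        have : dK M l (i+1) (fun s => (f + g) (Sum.inl s)) =
          dK M l (i+1) (fun s => f (Sum.inl s)) + dK M l (i+1) (fun s => g (Sum.inl s)) := by
            rw [← map_add]; rfl
        rw [this]
        have h2 : (fun s => (f + g) (Sum.inr s)) =
          (fun s => f (Sum.inr s)) + (fun s => g (Sum.inr s)) := rfl
        rw [h2, smul_add, map_add]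
        refine Eq.trans (congrArg₂ Sum.elim ?_ ?_) (elim_add _ _ _ _)
        · abel
        · abel
      map_smul' := by
        intro c f
        have : dK M l (i+1) (fun s => (c • f) (Sum.inl s)) =
          c • dK M l (i+1) (fun s => f (Sum.inl s)) := by
            rw [← map_smul]; rfl
        rw [this]
        have h2 : (fun s => (c • f) (Sum.inr s)) = c • (fun s => f (Sum.inr s)) := rfl
        rw [h2, smul_comm x c, map_smul, RingHom.id_apply]
        refine Eq.trans (congrArg₂ Sum.elim ?_ ?_) (elim_smul _ _ _)
        · rw [smul_add]
        · rw [smul_neg] }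

section
variable {M : Type} [AddCommGroup M] [Module R M]

/-- pair of a cone element -/
def pr {x : R} {l : List R} {i : ℕ} (a : S l (i + 1) → M) (b : S l i → M) :
    S (x :: l) (i + 1) → M := Sum.elim a b

lemma pr_surj {x : R} {l : List R} {i : ℕ} (f : S (x :: l) (i + 1) → M) :
    ∃ (a : S l (i + 1) → M) (b : S l i → M), f = pr a b :=
  ⟨fun s => f (Sum.inl s), fun s => f (Sum.inr s), by
    funext s; rcases s with s | s <;> rfl⟩

lemma pr_inj {x : R} {l : List R} {i : ℕ} {a a' : S l (i + 1) → M} {b b' : S l i → M} :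
    (pr (x := x) a b = pr a' b') ↔ a = a' ∧ b = b' := by
  constructor
  · intro h
    exact ⟨funext fun s => congrFun h (Sum.inl s), funext fun s => congrFun h (Sum.inr s)⟩
  · rintro ⟨rfl, rfl⟩; rfl

lemma pr_zero {x : R} {l : List R} {i : ℕ} :
    pr (x := x) (0 : S l (i + 1) → M) 0 = 0 := by
  funext s; rcases s with s | s <;> rfl

lemma pr_smul {x : R} {l : List R} {i : ℕ} (c : R) (a : S l (i + 1) → M) (b : S l i → M) :
    c • pr (x := x) a b = pr (c • a) (c • b) := by
  funext s; rcases s with s | s <;> rfl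

lemma dK_zero (x : R) (l : List R) (a : S l 1 → M) (b : S l 0 → M) :
    dK M (x :: l) 0 (pr a b) = dK M l 0 a + x • b := by
  simp only [dK]; rfl

lemma dK_succ (x : R) (l : List R) (i : ℕ) (a : S l (i + 2) → M) (b : S l (i + 1) → M) :
    dK M (x :: l) (i + 1) (pr a b) = pr (dK M l (i + 1) a + x • b) (-(dK M l i b)) := by
  simp only [dK]; rfl

lemma dd (l : List R) (i : ℕ) (f : S l (i + 2) → M) : dK M l i (dK M l (i + 1) f) = 0 := by
  induction l generalizing i with
  | nil => simp [dK]
  | cons x l ih =>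
    obtain ⟨a, b, rfl⟩ := pr_surj f
    rw [dK_succ]
    cases i with
    | zero => rw [dK_zero, map_add, ih, map_smul, zero_add, smul_neg, add_neg_cancel]; rfl
    | succ i =>
      rw [dK_succ, map_add, ih, map_smul, zero_add, smul_neg, add_neg_cancel, map_neg, ih, neg_zero,
        neg_zero, pr_zero]

variable {N : Type} [AddCommGroup N] [Module R N]

lemma dK_nat (φ : M →ₗ[R] N) (l : List R) (i : ℕ) (f : S l (i + 1) → M) :
    dK N l i (fun s => φ (f s)) = fun s => φ (dK M l i f s) := by
  induction l generalizing i with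
  | nil => simp [dK]; rfl
  | cons x l ih =>
    obtain ⟨a, b, rfl⟩ := pr_surj f
    have h1 : (fun s => φ (pr (x := x) a b s)) = pr (fun s => φ (a s)) (fun s => φ (b s)) := by
      funext s; rcases s with s | s <;> rfl
    rw [h1]
    cases i with
    | zero =>
      rw [dK_zero, ih, dK_zero]; funext s; simp
    | succ i =>
      rw [dK_succ, ih, ih, dK_succ]; funext s
      rcases s with s | s
      · change φ _ + x • φ _ = φ (_ + x • _); simp
      · change - φ _ = φ (- _); simp

instance finS (l : List R) (i : ℕ) : Finite (S l i) := by
  induction l generalizing i with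
  | nil => cases i with
    | zero => exact inferInstanceAs (Finite Unit)
    | succ i => exact inferInstanceAs (Finite Empty)
  | cons x l ih => cases i with
    | zero => exact ih 0
    | succ i =>
      have := ih i; have := ih (i + 1)
      exact inferInstanceAs (Finite (S l (i + 1) ⊕ S l i))

lemma emptyS (l : List R) (i : ℕ) (h : l.length < i) : IsEmpty (S l i) := by
  induction l generalizing i with
  | nil => cases i with
    | zero => simp at h
    | succ i => exact inferInstanceAs (IsEmpty Empty)
  | cons x l ih => cases i with
    | zero => simp at h
    | succ i =>
      simp at h
      have := ih i h; have := ih (i + 1) (by omega)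
      exact inferInstanceAs (IsEmpty (S l (i + 1) ⊕ S l i))

lemma nonemptyS (l : List R) : Nonempty (S l l.length) := by
  induction l with
  | nil => exact ⟨()⟩
  | cons x l ih => exact ⟨Sum.inr ih.some⟩

lemma uniqueS (l : List R) : Nonempty (Unique (S l 0)) := by
  induction l with
  | nil => exact ⟨inferInstanceAs (Unique Unit)⟩
  | cons x l ih => exact ih

lemma dK_kill (l : List R) (h : ∀ x ∈ l, ∀ m : M, x • m = 0) (i : ℕ) (f : S l (i + 1) → M) :
    dK M l i f = 0 := by
  induction l generalizing i with
  | nil => simp [dK]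
  | cons x l ih =>
    have ih' := ih (fun x hx => h x (by simp [hx]))
    have hx : ∀ (j : ℕ) (b : S l j → M), x • b = 0 := fun j b => by
      funext s; exact h x (by simp) _
    obtain ⟨a, b, rfl⟩ := pr_surj f
    cases i with
    | zero => rw [dK_zero, ih', hx, zero_add]; rfl
    | succ i => rw [dK_succ, ih', ih', hx, zero_add, neg_zero, pr_zero]

end

/-- `a` kills the Koszul homology in degree `i+1`. -/
def Kill (l : List R) (a : R) (i : ℕ) (M : Type) [AddCommGroup M] [Module R M] : Prop :=
  ∀ z : S l (i + 1) → M, dK M l i z = 0 → ∃ w, dK M l (i + 1) w = a • z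

section
variable {L M N : Type} [AddCommGroup L] [Module R L] [AddCommGroup M] [Module R M]
  [AddCommGroup N] [Module R N] {l : List R} {i : ℕ} {a b : R}

lemma Kill.mul (h : Kill l a i M) (c : R) : Kill l (c * a) i M := fun z hz => by
  obtain ⟨w, hw⟩ := h z hz
  exact ⟨c • w, by rw [map_smul, hw, mul_smul]⟩

lemma Kill.of_one (h : Kill l 1 i M) (c : R) : Kill l c i M := by
  simpa using h.mul c

lemma Kill.of_smul (h : ∀ m : M, a • m = 0) : Kill l a i M := fun z _ =>
  ⟨0, by rw [map_zero]; funext s; exact (h _).symm⟩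

lemma Kill.of_length (h : l.length ≤ i) : Kill l a i M := fun z _ => by
  have := emptyS l (i + 1) (by omega)
  exact ⟨0, Subsingleton.elim _ _⟩

lemma Kill.retract (f : M →ₗ[R] N) (g : N →ₗ[R] M) (hgf : ∀ m, g (f m) = m)
    (h : Kill l a i N) : Kill l a i M := fun z hz => by
  obtain ⟨w, hw⟩ := h (fun s => f (z s)) (by rw [dK_nat, hz]; funext s; simp)
  refine ⟨fun s => g (w s), ?_⟩
  rw [dK_nat, hw]
  funext s
  simp [hgf]

lemma Kill.equiv (e : M ≃ₗ[R] N) (h : Kill l a i N) : Kill l a i M :=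
  h.retract e.toLinearMap e.symm.toLinearMap (by simp)

lemma Kill.pi {ι : Type} {F : ι → Type} [∀ k, AddCommGroup (F k)] [∀ k, Module R (F k)]
    (h : ∀ k, Kill l a i (F k)) : Kill l a i ((k : ι) → F k) := fun z hz => by
  have h1 : ∀ k, ∃ w, dK (F k) l (i + 1) w = a • (fun s => z s k) := fun k => by
    apply h k
    have := dK_nat (LinearMap.proj k : ((k : ι) → F k) →ₗ[R] F k) l i z
    simp only [LinearMap.proj_apply] at this
    rw [this, hz]; rfl
  choose w hw using h1
  refine ⟨fun s k => w k s, ?_⟩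
  funext s k
  have := dK_nat (LinearMap.proj k : ((k : ι) → F k) →ₗ[R] F k) l (i + 1) (fun s k => w k s)
  simp only [LinearMap.proj_apply] at this
  rw [← congrFun this s, hw]; rfl

variable {f : L →ₗ[R] M} {g : M →ₗ[R] N}

lemma lift_fun {T : Type} (hg : Function.Surjective g) (z : T → N) :
    ∃ w : T → M, (fun s => g (w s)) = z :=
  ⟨fun s => (hg (z s)).choose, funext fun s => (hg (z s)).choose_spec⟩

lemma lift_ker {T : Type} (hfg : Function.Exact f g) (z : T → M) (hz : ∀ s, g (z s) = 0) :
    ∃ w : T → L, (fun s => f (w s)) = z :=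
  ⟨fun s => ((hfg _).1 (hz s)).choose, funext fun s => ((hfg _).1 (hz s)).choose_spec⟩

lemma Kill.ext (hf : Function.Injective f) (hg : Function.Surjective g)
    (hfg : Function.Exact f g) (h1 : Kill l a i L) (h2 : Kill l b i N) :
    Kill l (a * b) i M := fun z hz => by
  obtain ⟨w, hw⟩ := h2 (fun s => g (z s)) (by rw [dK_nat, hz]; funext s; simp)
  obtain ⟨w', rfl⟩ := lift_fun hg w
  rw [dK_nat] at hw
  obtain ⟨u, hu⟩ := lift_ker hfg (b • z - dK M l (i + 1) w') (fun s => by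
    have := congrFun hw s
    simp at this
    simp [this])
  obtain ⟨v, hv⟩ := h1 u (by
    have h3 : dK M l i (fun s => f (u s)) = 0 := by
      rw [hu, map_sub, map_smul, hz, dd]; simp
    rw [dK_nat] at h3
    funext s
    exact hf (by simpa using congrFun h3 s))
  refine ⟨a • w' + fun s => f (v s), ?_⟩
  rw [map_add, map_smul, dK_nat, hv]
  have h4 : (fun s => f ((a • u) s)) = a • (b • z - dK M l (i + 1) w') := by
    rw [← hu]; funext s; simp
  rw [h4, smul_sub, mul_smul]; abel

lemma Kill.down (hf : Function.Injective f) (hg : Function.Surjective g)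
    (hfg : Function.Exact f g) (hM : Kill l 1 i M) (h : Kill l a (i + 1) N) :
    Kill l a i L := fun z hz => by
  obtain ⟨w, hw⟩ := hM (fun s => f (z s)) (by rw [dK_nat, hz]; funext s; simp)
  rw [one_smul] at hw
  obtain ⟨v, hv⟩ := h (fun s => g (w s)) (by
    rw [dK_nat, hw]; funext s; exact hfg.apply_apply_eq_zero _)
  obtain ⟨v', rfl⟩ := lift_fun hg v
  rw [dK_nat] at hv
  obtain ⟨u, hu⟩ := lift_ker hfg (a • w - dK M l (i + 2) v') (fun s => by
    have := congrFun hv s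
    simp at this
    simp [this])
  refine ⟨u, ?_⟩
  have h3 : dK M l (i + 1) (fun s => f (u s)) = a • fun s => f (z s) := by
    rw [hu, map_sub, map_smul, dd, hw, sub_zero]
  rw [dK_nat] at h3
  funext s
  exact hf (by simpa using congrFun h3 s)

lemma Kill.up (hf : Function.Injective f) (hg : Function.Surjective g)
    (hfg : Function.Exact f g) (hM : Kill l 1 (i + 1) M) (h : Kill l a i L) :
    Kill l a (i + 1) N := fun z hz => by
  obtain ⟨z', rfl⟩ := lift_fun hg z
  rw [dK_nat] at hz
  obtain ⟨u, hu⟩ := lift_ker hfg (dK M l (i + 1) z') (fun s => congrFun hz s)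
  obtain ⟨v, hv⟩ := h u (by
    have h3 : dK M l i (fun s => f (u s)) = 0 := by rw [hu, dd]
    rw [dK_nat] at h3
    funext s
    exact hf (by simpa using congrFun h3 s))
  obtain ⟨w, hw⟩ := hM (a • z' - fun s => f (v s)) (by
    rw [map_sub, map_smul, dK_nat, hv, ← hu]; funext s; simp)
  refine ⟨fun s => g (w s), ?_⟩
  rw [dK_nat, hw]
  funext s
  simp [hfg.apply_apply_eq_zero]

lemma Kill.top {j : ℕ} (hj : l.length = j + 1) (hl : ∀ x ∈ l, ∀ m : M, x • m = 0)
    (h : Kill l a j M) (m : M) : a • m = 0 := by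
  obtain ⟨w, hw⟩ := h (fun _ => m) (dK_kill l hl _ _)
  have := emptyS l (j + 1 + 1) (by omega)
  have hw0 : w = 0 := Subsingleton.elim _ _
  rw [hw0, map_zero] at hw
  obtain ⟨s⟩ := nonemptyS l
  rw [hj] at s
  exact (congrFun hw s).symm

end

/-- the Koszul complex is acyclic in positive degrees -/
def Acyc (l : List R) (M : Type) [AddCommGroup M] [Module R M] : Prop := ∀ i, Kill l 1 i M

lemma Acyc.proj {l : List R} (h : Acyc l R) (P : Type) [AddCommGroup P] [Module R P]
    [Module.Finite R P] [Module.Projective R P] : Acyc l P := fun i => by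
  obtain ⟨n, f, g, -, -, hfg⟩ := Module.Finite.exists_comp_eq_id_of_projective R P
  refine Kill.retract (N := Fin n → R) g f (fun m => ?_) (Kill.pi fun _ => h i)
  exact LinearMap.congr_fun hfg m

section
variable {M : Type} [AddCommGroup M] [Module R M]

lemma range_zero (l : List R) (f : S l 0 → M) (s : S l 0) :
    (∃ w, dK M l 0 w = f) ↔ f s ∈ Ideal.ofList l • (⊤ : Submodule R M) := by
  induction l with
  | nil =>
    simp [dK]
    have : ∀ s', s' = s := fun s' => by
      change Unit at s'; change Unit at s; rfl
    constructor
    · rintro rfl; rfl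
    · intro h; funext s'; rw [this s', h]; rfl
  | cons x l ih =>
    have hu := (uniqueS l).some
    change S l 0 at s
    rw [Ideal.ofList_cons_smul, Submodule.mem_sup]
    constructor
    · rintro ⟨w, rfl⟩
      obtain ⟨a, b, rfl⟩ := pr_surj w
      refine ⟨x • b s, Submodule.smul_mem_pointwise_smul _ _ _ trivial, dK M l 0 a s,
        (ih _ s).1 ⟨_, rfl⟩, ?_⟩
      rw [dK_zero, add_comm]; rfl
    · rintro ⟨y, hy, z, hz, hyz⟩
      obtain ⟨m, -, rfl⟩ := Submodule.mem_smul_pointwise_iff_exists _ _ _ |>.1 hy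
      obtain ⟨w, hw⟩ := (ih (fun _ => z) s).2 hz
      refine ⟨pr w (fun _ => m), ?_⟩
      rw [dK_zero, hw]
      funext s'
      change S l 0 at s'
      have : s' = s := Subsingleton.elim _ _
      rw [this, ← hyz, add_comm]; rfl

lemma Acyc.cons {x : R} {l : List R} (h : Acyc l M)
    (hx : IsSMulRegular (M ⧸ Ideal.ofList l • (⊤ : Submodule R M)) x) : Acyc (x :: l) M := by
  have hreg : ∀ b : S l 0 → M, (∃ w, dK M l 0 w = x • b) → ∃ w, dK M l 0 w = b := fun b hb => by
    have hu := (uniqueS l).some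
    rw [range_zero l _ default] at hb ⊢
    rw [← Submodule.Quotient.mk_eq_zero] at hb ⊢
    exact hx.right_eq_zero_of_smul hb
  intro i z hz
  obtain ⟨a, b, rfl⟩ := pr_surj z
  have key : ∀ v, dK M l i v = b → dK M l i (a + x • v) = 0 →
      ∃ w, dK M (x :: l) (i + 1) w = (1 : R) • pr a b := by
    intro v hv h0
    obtain ⟨u, hu⟩ := h i _ h0
    refine ⟨pr u (-v), ?_⟩
    rw [dK_succ, hu, map_neg, hv, one_smul, one_smul]
    simp
  cases i with
  | zero =>
    rw [dK_zero] at hz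
    obtain ⟨v, hv⟩ := hreg b ⟨-a, by rw [map_neg]; exact neg_eq_of_add_eq_zero_right hz⟩
    exact key v hv (by rw [map_add, map_smul, hv, hz]; rfl)
  | succ i =>
    rw [dK_succ, ← pr_zero, pr_inj] at hz
    obtain ⟨v, hv⟩ := h i b (by simpa using hz.2)
    rw [one_smul] at hv
    exact key v hv (by rw [map_add, map_smul, hv, hz.1])

lemma Acyc.of_cons [IsNoetherianRing R] [IsLocalRing R] [Module.Finite R M]
    {x : R} {l : List R} (hx : x ∈ IsLocalRing.maximalIdeal R) (h : Acyc (x :: l) M) :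
    Acyc l M ∧ IsSMulRegular (M ⧸ Ideal.ofList l • (⊤ : Submodule R M)) x := by
  constructor
  · intro i
    let Z := LinearMap.ker (dK M l i)
    let B := LinearMap.range (dK M l (i + 1))
    have hZB : Z ≤ B ⊔ IsLocalRing.maximalIdeal R • Z := by
      intro z hz
      have hz0 : dK M l i z = 0 := hz
      have hc : dK M (x :: l) i (pr z 0) = 0 := by
        cases i with
        | zero => rw [dK_zero, hz0, smul_zero, zero_add]; rfl
        | succ i => rw [dK_succ, hz0]; simp [pr_zero]
      obtain ⟨w, hw⟩ := h i _ hc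
      obtain ⟨u, v, rfl⟩ := pr_surj w
      rw [dK_succ, one_smul, pr_inj] at hw
      rw [← hw.1]
      refine Submodule.add_mem_sup ⟨u, rfl⟩ (Submodule.smul_mem_smul hx ?_)
      have h5 : dK M l i v = 0 := by simpa using hw.2
      exact h5
    have hle : Z ≤ B := Submodule.le_of_le_smul_of_le_jacobson_bot
      (IsNoetherian.noetherian Z) (IsLocalRing.maximalIdeal_le_jacobson ⊥) hZB
    intro z hz
    obtain ⟨w, hw⟩ := hle hz
    exact ⟨w, by rw [hw, one_smul]⟩
  · have hu := (uniqueS l).some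
    rw [isSMulRegular_iff_right_eq_zero_of_smul]
    intro q hq
    obtain ⟨m, rfl⟩ := Submodule.Quotient.mk_surjective _ q
    rw [← Submodule.Quotient.mk_smul, Submodule.Quotient.mk_eq_zero] at hq
    rw [Submodule.Quotient.mk_eq_zero]
    obtain ⟨w, hw⟩ := (range_zero l (fun _ => x • m) default).2 hq
    refine (range_zero l (fun _ => m) default).1 ?_
    obtain ⟨v, hv⟩ := h 0 (pr (-w) (fun _ => m)) (by
      rw [dK_zero, map_neg, hw]; exact neg_add_cancel (G := S l 0 → M) _)
    obtain ⟨u, v, rfl⟩ := pr_surj v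
    rw [dK_succ, one_smul, pr_inj] at hv
    exact ⟨-v, by rw [map_neg, hv.2]⟩

lemma acyc_iff [IsNoetherianRing R] [IsLocalRing R] [Module.Finite R M] (l : List R)
    (hl : ∀ x ∈ l, x ∈ IsLocalRing.maximalIdeal R) :
    Acyc l M ↔ RingTheory.Sequence.IsWeaklyRegular M l.reverse := by
  induction l with
  | nil =>
    simp
    exact fun i => Kill.of_length (by simp)
  | cons x l ih =>
    have ih' := ih (fun x hx => hl x (by simp [hx]))
    have hrev : Ideal.ofList l.reverse = Ideal.ofList l := by
      simp [Ideal.ofList]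
    rw [List.reverse_cons, RingTheory.Sequence.isWeaklyRegular_append_iff, ← ih',
      RingTheory.Sequence.isWeaklyRegular_singleton_iff, hrev]
    exact ⟨fun h => h.of_cons (hl x (by simp)), fun h => h.1.cons h.2⟩

lemma kill_pow (l : List R) (y : R) (hy : y ∈ l) :
    ∃ n : ℕ, (∀ z : S l 0 → M, ∃ w, dK M l 0 w = (y ^ n) • z) ∧ ∀ i, Kill l (y ^ n) i M := by
  induction l with
  | nil => simp at hy
  | cons x l ih =>
    rcases List.mem_cons.1 hy with rfl | hy
    · refine ⟨1, fun z => ⟨pr 0 z, (dK_zero y l 0 z).trans (by rw [map_zero, zero_add, pow_one]; rfl)⟩, fun i z hz => ?_⟩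
      obtain ⟨a, b, rfl⟩ := pr_surj z
      refine ⟨pr 0 a, ?_⟩
      rw [dK_succ, pow_one, pr_smul, pr_inj]
      refine ⟨by simp, ?_⟩
      cases i with
      | zero =>
        rw [dK_zero] at hz
        exact neg_eq_of_add_eq_zero_right hz
      | succ i =>
        rw [dK_succ, ← pr_zero, pr_inj] at hz
        exact neg_eq_of_add_eq_zero_right hz.1
    · obtain ⟨n, h0, h1⟩ := ih hy
      refine ⟨n + n, fun z => ?_, fun i z hz => ?_⟩
      · obtain ⟨w, hw⟩ := h0 ((y ^ n) • z)
        exact ⟨pr w 0, by rw [dK_zero, hw, pow_add, mul_smul, smul_zero, add_zero]; rfl⟩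
      · obtain ⟨a, b, rfl⟩ := pr_surj z
        have key : ∀ c, dK M l i c = y ^ n • b → dK M l i a + x • b = 0 →
            ∃ w, dK M (x :: l) (i + 1) w = (y ^ (n + n)) • pr a b := by
          intro c hc h2
          obtain ⟨u, hu⟩ := h1 i (y ^ n • a + x • c) (by
            rw [map_add, map_smul, map_smul, hc, smul_comm x, ← smul_add, h2, smul_zero])
          refine ⟨pr u (-(y ^ n • c)), ?_⟩
          rw [dK_succ, hu, map_neg, map_smul, hc, pr_smul, pr_inj, pow_add, mul_smul, mul_smul,
            neg_neg, smul_add, smul_neg, smul_comm x]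
          exact ⟨by abel, rfl⟩
        cases i with
        | zero =>
          rw [dK_zero] at hz
          obtain ⟨c, hc⟩ := h0 b
          exact key c hc hz
        | succ i =>
          rw [dK_succ, ← pr_zero, pr_inj] at hz
          obtain ⟨c, hc⟩ := h1 i b (by simpa using hz.2)
          exact key c hc hz.1

end
end Pf

namespace Pf

section Res
variable {R : Type} [CommRing R] {X : ModuleCat.{0} R → Prop}

/-- membership of an unbundled module -/
abbrev In (X : ModuleCat.{0} R → Prop) (M : Type) [AddCommGroup M] [Module R M] : Prop :=
  X (ModuleCat.of R M)

section
variable {A B C : Type} [AddCommGroup A] [Module R A] [AddCommGroup B] [Module R B]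
  [AddCommGroup C] [Module R C]

lemma r_iso (hX : Resolving R X) (e : A ≃ₗ[R] B) (h : In X A) : In X B :=
  hX.summand (ModuleCat.of R A) (ModuleCat.of R B) (ModuleCat.of R PUnit) h
    ⟨e.trans (LinearEquiv.prodUnique (R := R) (M := B) (M₂ := PUnit)).symm⟩

lemma r_ext (hX : Resolving R X) {f : A →ₗ[R] B} {g : B →ₗ[R] C} (hf : Function.Injective f)
    (hg : Function.Surjective g) (h : Function.Exact f g) (hA : In X A) (hC : In X C) : In X B :=
  hX.extension (ModuleCat.of R A) (ModuleCat.of R B) (ModuleCat.of R C) f g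
    ⟨hf, hg, h.linearMap_ker_eq⟩ hA hC

lemma r_ker (hX : Resolving R X) {f : A →ₗ[R] B} {g : B →ₗ[R] C} (hf : Function.Injective f)
    (hg : Function.Surjective g) (h : Function.Exact f g) (hB : In X B) (hC : In X C) : In X A :=
  hX.ker_epi (ModuleCat.of R A) (ModuleCat.of R B) (ModuleCat.of R C) f g
    ⟨hf, hg, h.linearMap_ker_eq⟩ hB hC

lemma r_proj (hX : Resolving R X) [Module.Finite R A] [Module.Projective R A] : In X A :=
  hX.proj _ ⟨inferInstanceAs (Module.Finite R A), inferInstanceAs (Module.Projective R A)⟩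

lemma r_zero (hX : Resolving R X) [Subsingleton A] : In X A := by
  have : Module.Free R A := Module.Free.of_subsingleton R A
  have : Module.Finite R A := inferInstance
  exact r_proj hX

lemma r_ext_sub (hX : Resolving R X) (N : Submodule R A) (h1 : In X N) (h2 : In X (A ⧸ N)) :
    In X A :=
  r_ext hX N.injective_subtype N.mkQ_surjective
    (LinearMap.exact_iff.2 (by simp)) h1 h2

lemma r_ker_surj (hX : Resolving R X) {g : B →ₗ[R] C} (hg : Function.Surjective g)
    (hB : In X B) (hC : In X C) : In X (LinearMap.ker g) :=
  r_ker hX (LinearMap.ker g).injective_subtype hg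
    (LinearMap.exact_iff.2 (by simp)) hB hC

/-- pullback -/
def pb (f : A →ₗ[R] C) (g : B →ₗ[R] C) : Submodule R (A × B) :=
  LinearMap.ker (f.coprod (-g))

lemma mem_pb (f : A →ₗ[R] C) (g : B →ₗ[R] C) (x : A × B) : x ∈ pb f g ↔ f x.1 = g x.2 := by
  simp [pb, ← sub_eq_add_neg, sub_eq_zero]

/-- inclusion of the kernel of the second map -/
def pbr (f : A →ₗ[R] C) (g : B →ₗ[R] C) : LinearMap.ker g →ₗ[R] pb f g :=
  ((LinearMap.inr R A B).comp (LinearMap.ker g).subtype).codRestrict _ (by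
    intro c; rw [mem_pb]; simp)

/-- inclusion of the kernel of the first map -/
def pbl (f : A →ₗ[R] C) (g : B →ₗ[R] C) : LinearMap.ker f →ₗ[R] pb f g :=
  ((LinearMap.inl R A B).comp (LinearMap.ker f).subtype).codRestrict _ (by
    intro c; rw [mem_pb]; simp)

/-- first projection -/
def pbf (f : A →ₗ[R] C) (g : B →ₗ[R] C) : pb f g →ₗ[R] A :=
  (LinearMap.fst R A B).comp (pb f g).subtype

/-- second projection -/
def pbs (f : A →ₗ[R] C) (g : B →ₗ[R] C) : pb f g →ₗ[R] B :=
  (LinearMap.snd R A B).comp (pb f g).subtype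

lemma pb_right (f : A →ₗ[R] C) (g : B →ₗ[R] C) (hg : Function.Surjective g) :
    Function.Injective (pbr f g) ∧ Function.Surjective (pbf f g) ∧
      Function.Exact (pbr f g) (pbf f g) := by
  refine ⟨fun a b h => ?_, fun a => ?_, fun x => ⟨fun h => ?_, ?_⟩⟩
  · have := congrArg (fun t : pb f g => t.1.2) h
    exact Subtype.ext this
  · obtain ⟨b, hb⟩ := hg (f a)
    exact ⟨⟨(a, b), (mem_pb _ _ _).2 hb.symm⟩, rfl⟩
  · obtain ⟨⟨a, b⟩, hx⟩ := x
    have ha : a = 0 := h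
    subst ha
    rw [mem_pb] at hx
    exact ⟨⟨b, by simpa using hx.symm⟩, rfl⟩
  · rintro ⟨y, rfl⟩; rfl

lemma pb_left (f : A →ₗ[R] C) (g : B →ₗ[R] C) (hf : Function.Surjective f) :
    Function.Injective (pbl f g) ∧ Function.Surjective (pbs f g) ∧
      Function.Exact (pbl f g) (pbs f g) := by
  refine ⟨fun a b h => ?_, fun b => ?_, fun x => ⟨fun h => ?_, ?_⟩⟩
  · have := congrArg (fun t : pb f g => t.1.1) h
    exact Subtype.ext this
  · obtain ⟨a, ha⟩ := hf (g b)
    exact ⟨⟨(a, b), (mem_pb _ _ _).2 ha⟩, rfl⟩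
  · obtain ⟨⟨a, b⟩, hx⟩ := x
    have hb : b = 0 := h
    subst hb
    rw [mem_pb] at hx
    exact ⟨⟨a, by simpa using hx⟩, rfl⟩
  · rintro ⟨y, rfl⟩; rfl

/-- Schanuel-type exchange -/
lemma exchange (hX : Resolving R X) {f : A →ₗ[R] C} {g : B →ₗ[R] C}
    (hf : Function.Surjective f) (hg : Function.Surjective g)
    (hA : In X A) (hB : In X B) (h : In X (LinearMap.ker g)) : In X (LinearMap.ker f) := by
  obtain ⟨a1, a2, a3⟩ := pb_right f g hg
  obtain ⟨b1, b2, b3⟩ := pb_left f g hf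
  exact r_ker hX b1 b2 b3 (r_ext hX a1 a2 a3 h hA) hB

end

/-- modules with a first syzygy in `X` -/
def Up (X : ModuleCat.{0} R → Prop) (N : ModuleCat.{0} R) : Prop :=
  ∃ K, IsSyzygy R K N ∧ X K

variable {A B C P : Type} [AddCommGroup A] [Module R A] [AddCommGroup B] [Module R B]
  [AddCommGroup C] [Module R C] [AddCommGroup P] [Module R P]

lemma up_mk [Module.Finite R P] [Module.Projective R P] {f : P →ₗ[R] C}
    (hf : Function.Surjective f) (h : In X (LinearMap.ker f)) : In (Up X) C :=
  ⟨ModuleCat.of R (LinearMap.ker f), ⟨ModuleCat.of R P, f,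
    ⟨inferInstanceAs (Module.Finite R P), inferInstanceAs (Module.Projective R P)⟩, hf,
    ⟨LinearEquiv.refl R _⟩⟩, h⟩

lemma up_ker (hX : Resolving R X) {f : B →ₗ[R] C}
    (hf : Function.Surjective f) (hB : In X B) (h : In (Up X) C) : In X (LinearMap.ker f) := by
  obtain ⟨K, ⟨Q, g, ⟨h1, h2⟩, hg, ⟨e⟩⟩, hK⟩ := h
  exact exchange (B := Q) hX hf hg hB (r_proj hX) (r_iso (A := K) hX e hK)

lemma up_fin (h : In (Up X) C) : Module.Finite R C := by
  obtain ⟨K, ⟨Q, g, ⟨h1, h2⟩, hg, ⟨e⟩⟩, hK⟩ := h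
  exact Module.Finite.of_surjective g hg

lemma exists_cover [Module.Finite R C] :
    ∃ (n : ℕ) (f : (Fin n → R) →ₗ[R] C), Function.Surjective f :=
  Module.Finite.exists_fin' R C

lemma le_up (hX : Resolving R X) (h : In X C) : In (Up X) C := by
  have : Module.Finite R C := hX.fg _ h
  obtain ⟨n, f, hf⟩ := exists_cover (R := R) (C := C)
  exact up_mk hf (r_ker_surj hX hf (r_proj hX) h)

lemma up_horse {f : A →ₗ[R] B} {g : B →ₗ[R] C} (hf : Function.Injective f)
    (hg : Function.Surjective g) (h : Function.Exact f g) [Module.Finite R A] [Module.Finite R C] :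
    ∃ (n m : ℕ) (p : (Fin n → R) →ₗ[R] A) (q : (Fin m → R) →ₗ[R] C)
      (r : ((Fin n → R) × (Fin m → R)) →ₗ[R] B)
      (i : LinearMap.ker p →ₗ[R] LinearMap.ker r) (j : LinearMap.ker r →ₗ[R] LinearMap.ker q),
      Function.Surjective p ∧ Function.Surjective q ∧ Function.Surjective r ∧
      Function.Injective i ∧ Function.Surjective j ∧ Function.Exact i j := by
  obtain ⟨n, p, hp⟩ := exists_cover (R := R) (C := A)
  obtain ⟨m, q, hq⟩ := exists_cover (R := R) (C := C)
  obtain ⟨q', hq'⟩ := Module.projective_lifting_property g q hg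
  have hq1 : ∀ x, g (q' x) = q x := fun x => LinearMap.congr_fun hq' x
  have h0 : ∀ x, g (f x) = 0 := h.apply_apply_eq_zero
  let r := (f.comp p).coprod q'
  have hr : ∀ x, r x = f (p x.1) + q' x.2 := fun x => by simp [r]
  refine ⟨n, m, p, q, r,
    ((LinearMap.inl R _ _).comp (LinearMap.ker p).subtype).codRestrict _ (fun c => by
      simp [hr]),
    ((LinearMap.snd R _ _).comp (LinearMap.ker r).subtype).codRestrict _ (fun c => ?_),
    hp, hq, fun b => ?_, fun a b hab => ?_, fun c => ?_, fun x => ⟨fun hx => ?_, ?_⟩⟩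
  · have := congrArg g (c.2 : r c.1 = 0)
    rw [hr, map_add, h0, zero_add, hq1, map_zero] at this
    simpa using this
  · obtain ⟨y, hy⟩ := hq (g b)
    obtain ⟨a, ha⟩ := (h (b - q' y)).1 (by rw [map_sub, hq1, hy, sub_self])
    obtain ⟨x, rfl⟩ := hp a
    exact ⟨(x, y), by rw [hr, ha]; simp⟩
  · have := congrArg (fun t : LinearMap.ker r => t.1.1) hab
    exact Subtype.ext this
  · obtain ⟨y, hy⟩ := c
    have hy' : q y = 0 := hy
    obtain ⟨a, ha⟩ := (h (q' y)).1 (by rw [hq1, hy'])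
    obtain ⟨x, rfl⟩ := hp a
    exact ⟨⟨(-x, y), by simp [hr, ha]⟩, rfl⟩
  · obtain ⟨⟨a, b⟩, hab⟩ := x
    have hb : b = 0 := congrArg Subtype.val hx
    subst hb
    have h1 : r (a, 0) = 0 := hab
    rw [hr] at h1
    simp only [map_zero, add_zero] at h1
    exact ⟨⟨a, hf (by rw [h1, map_zero])⟩, rfl⟩
  · rintro ⟨y, rfl⟩; rfl

/-- a product submodule is a product -/
def prodEq (N : Submodule R A) (N' : Submodule R B) : (N.prod N') ≃ₗ[R] N × N' where
  toFun x := (⟨x.1.1, x.2.1⟩, ⟨x.1.2, x.2.2⟩)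
  invFun x := ⟨(x.1.1, x.2.1), x.1.2, x.2.2⟩
  map_add' _ _ := rfl
  map_smul' _ _ := rfl
  left_inv _ := rfl
  right_inv _ := rfl

lemma up_resolving [IsNoetherianRing R] (hX : Resolving R X) : Resolving R (Up X) where
  fg M h := up_fin (C := M) h
  proj M h := le_up (C := M) hX (hX.proj M h)
  summand M N N' h := by
    rintro ⟨e⟩
    have : Module.Finite R M := up_fin (C := M) h
    have h1 : Module.Finite R (N × N') := Module.Finite.equiv e
    have : Module.Finite R N := Module.Finite.of_surjective (LinearMap.fst R N N')
      LinearMap.fst_surjective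
    have : Module.Finite R N' := Module.Finite.of_surjective (LinearMap.snd R N N')
      LinearMap.snd_surjective
    obtain ⟨n, p, hp⟩ := exists_cover (R := R) (C := N)
    obtain ⟨m, q, hq⟩ := exists_cover (R := R) (C := N')
    let r := e.symm.toLinearMap.comp (p.prodMap q)
    have hr : Function.Surjective r := e.symm.surjective.comp (Prod.map_surjective.2 ⟨hp, hq⟩)
    have h2 := up_ker (C := M) hX hr (r_proj hX) h
    have hk : LinearMap.ker r = (LinearMap.ker p).prod (LinearMap.ker q) := by
      ext x; simp [r]
    refine up_mk hp (hX.summand _ _ (ModuleCat.of R (LinearMap.ker q)) h2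
      ⟨(LinearEquiv.ofEq _ _ hk).trans (prodEq _ _)⟩)
  extension L M N f g h hL hN := by
    have : Module.Finite R L := up_fin (C := L) hL
    have : Module.Finite R N := up_fin (C := N) hN
    obtain ⟨n, m, p, q, r, i, j, hp, hq, hr, hi, hj, hij⟩ := up_horse h.1 h.2.1
      (LinearMap.exact_iff.2 h.2.2)
    exact up_mk hr (r_ext hX hi hj hij (up_ker (C := L) hX hp (r_proj hX) hL)
      (up_ker (C := N) hX hq (r_proj hX) hN))
  ker_epi L M N f g h hM hN := by
    have : Module.Finite R N := up_fin (C := N) hN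
    have : Module.Finite R M := up_fin (C := M) hM
    have : Module.Finite R L := Module.Finite.of_injective f h.1
    obtain ⟨n, m, p, q, r, i, j, hp, hq, hr, hi, hj, hij⟩ := up_horse h.1 h.2.1
      (LinearMap.exact_iff.2 h.2.2)
    exact up_mk hp (r_ker hX hi hj hij (up_ker (C := M) hX hr (r_proj hX) hM)
      (up_ker (C := N) hX hq (r_proj hX) hN))

lemma up_quot (hX : Resolving R X) (N : Submodule R A) (hN : In X N) (hA : In (Up X) A) :
    In (Up X) (A ⧸ N) := by
  have := up_fin hA
  obtain ⟨n, p, hp⟩ := exists_cover (R := R) (C := A)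
  have hk := up_ker hX hp (r_proj hX) hA
  let g := N.mkQ.comp p
  have hg : Function.Surjective g := N.mkQ_surjective.comp hp
  have hpg : ∀ x, g x = 0 ↔ p x ∈ N := fun x => by simp [g]
  refine up_mk hg (r_ext hX
    (f := (LinearMap.ker p).subtype.codRestrict (LinearMap.ker g) (fun c => ?_))
    (g := (p.comp (LinearMap.ker g).subtype).codRestrict N (fun c => (hpg _).1 c.2))
    ?_ ?_ ?_ hk hN)
  · have : p c.1 = 0 := c.2
    exact (hpg _).2 (by simp [this])
  · intro a b hab
    exact Subtype.ext (congrArg (fun t : LinearMap.ker g => t.1) hab)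
  · rintro ⟨a, ha⟩
    obtain ⟨x, rfl⟩ := hp a
    exact ⟨⟨x, (hpg x).2 ha⟩, rfl⟩
  · intro x
    constructor
    · intro hx
      have : p x.1 = 0 := congrArg Subtype.val hx
      exact ⟨⟨x.1, this⟩, rfl⟩
    · rintro ⟨y, rfl⟩
      exact Subtype.ext y.2

lemma up_sub (hX : Resolving R X) (N : Submodule R A) (hA : In X A) (h : In (Up X) (A ⧸ N)) :
    In X N := by
  have h1 := up_ker hX N.mkQ_surjective hA h
  exact r_iso hX (LinearEquiv.ofEq _ _ N.ker_mkQ) h1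

/-- iterates -/
def W (X : ModuleCat.{0} R → Prop) : ℕ → ModuleCat.{0} R → Prop
  | 0 => X
  | t + 1 => Up (W X t)

lemma W_res [IsNoetherianRing R] (hX : Resolving R X) (t : ℕ) : Resolving R (W X t) := by
  induction t with
  | zero => exact hX
  | succ t ih => exact up_resolving ih

lemma W_mono [IsNoetherianRing R] (hX : Resolving R X) {s t : ℕ} (hst : s ≤ t) (h : In (W X s) A) : In (W X t) A := by
  induction t, hst using Nat.le_induction with
  | base => exact h
  | succ t _ ih => exact le_up (W_res hX t) ih

lemma W_of_syz [IsNoetherianRing R] (hX : Resolving R X) (n : ℕ) (K M : ModuleCat.{0} R) (s : ℕ) (h : W X s K)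
    (hK : IsNthSyzygy R n K M) : W X (s + n) M := by
  induction n generalizing K s with
  | zero =>
    obtain ⟨e⟩ := hK
    exact r_iso (A := K) (B := M) (W_res hX s) e h
  | succ n ih =>
    obtain ⟨K', h1, h2⟩ := hK
    have := ih K' (s + 1) ⟨K, h2, h⟩ h1
    rwa [show s + (n + 1) = s + 1 + n by omega]

end Res
end Pf

namespace Pf
open RingTheory.Sequence

section Pow
variable {R : Type} [CommRing R] [IsNoetherianRing R] [IsLocalRing R]
  {M : Type} [AddCommGroup M] [Module R M] [Module.Finite R M]

lemma wr_pow_aux (j : ℕ) (rs ts : List R)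
    (hm : ∀ x ∈ rs ++ ts, x ∈ IsLocalRing.maximalIdeal R)
    (h : IsWeaklyRegular M (rs ++ ts)) :
    IsWeaklyRegular M (rs.map (fun x => x ^ (j + 1)) ++ ts) := by
  induction rs generalizing ts with
  | nil => simpa using h
  | cons x rs ih =>
    have hp : List.Perm (x :: rs ++ ts) (rs ++ ts ++ [x]) := by
      simpa using (List.perm_append_singleton x (rs ++ ts)).symm
    have h1 := IsLocalRing.isWeaklyRegular_of_perm_of_subset_maximalIdeal h hp hm
    have hx : x ∈ IsLocalRing.maximalIdeal R := hm x (by simp)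
    have h2 : IsWeaklyRegular M (rs ++ (ts ++ [x ^ (j + 1)])) := by
      rw [← List.append_assoc]
      rw [isWeaklyRegular_append_iff, isWeaklyRegular_singleton_iff] at h1 ⊢
      exact ⟨h1.1, h1.2.pow _⟩
    have hm2 : ∀ y ∈ rs ++ (ts ++ [x ^ (j + 1)]), y ∈ IsLocalRing.maximalIdeal R := by
      intro y hy
      simp only [List.mem_append, List.mem_singleton] at hy
      rcases hy with hy | hy | rfl
      · exact hm y (by simp [hy])
      · exact hm y (by simp [hy])
      · exact Ideal.pow_mem_of_mem _ hx _ (by omega)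
    have h3 := ih _ hm2 h2
    refine IsLocalRing.isWeaklyRegular_of_perm_of_subset_maximalIdeal h3 ?_ ?_
    · rw [← List.append_assoc]
      exact List.perm_append_singleton _ _
    · intro y hy
      simp only [List.mem_append, List.mem_map] at hy
      rcases hy with ⟨z, hz, rfl⟩ | hy
      · exact Ideal.pow_mem_of_mem _ (hm z (by simp [hz])) _ (by omega)
      · exact hm2 y (List.mem_append_right _ (List.mem_append.2 hy))

lemma wr_pow (j : ℕ) (rs : List R) (hm : ∀ x ∈ rs, x ∈ IsLocalRing.maximalIdeal R)
    (h : IsWeaklyRegular M rs) : IsWeaklyRegular M (rs.map (fun x => x ^ (j + 1))) := by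
  simpa using wr_pow_aux j rs [] (by simpa using hm) (by simpa using h)

end Pow

section Ann
variable {R : Type} [CommRing R] [IsNoetherianRing R]

lemma unif_ann (p : Ideal R) (hp : p ∈ minimalPrimes R) (d : ℕ) (e : ℕ) :
    ∀ i, d ≤ i + e → ∀ (M : Type) [AddCommGroup M] [Module R M] [Module.Finite R M],
    ∃ a, a ∉ p ∧ ∀ l : List R, l.length = d → Acyc l R → Kill l a i M := by
  have hpp : p.IsPrime := hp.1.1
  have hpa : p ∈ associatedPrimes R R := by
    apply Module.associatedPrimes.minimalPrimes_annihilator_subset_associatedPrimes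
    have : Module.annihilator R R = ⊥ := by
      rw [Module.annihilator_eq_bot]; infer_instance
    rw [this]; exact hp
  obtain ⟨-, y, hy⟩ := (isAssociatedPrime_iff).1 hpa
  induction e with
  | zero =>
    intro i hi M _ _ _
    exact ⟨1, (Ideal.ne_top_iff_one p).1 hpp.ne_top, fun l hl _ => Kill.of_length (by omega)⟩
  | succ e ih =>
    intro i hi M _ _ hM
    induction hM using IsNoetherianRing.induction_on_isQuotientEquivQuotientPrime R with
    | subsingleton N =>
      exact ⟨1, (Ideal.ne_top_iff_one p).1 hpp.ne_top,
        fun l hl _ => Kill.of_smul fun m => Subsingleton.elim _ _⟩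
    | quotient N q f =>
      by_cases hq : q.1 ≤ p
      · have hqp : p = q.1 := le_antisymm (hp.2 ⟨q.2, bot_le⟩ hq) hq
        obtain ⟨a, ha, h⟩ := ih (i + 1) (by omega) (R ⧸ LinearMap.range (LinearMap.toSpanSingleton R R y))
        refine ⟨a, ha, fun l hl hl' => ?_⟩
        have hk : LinearMap.ker (LinearMap.toSpanSingleton R R y) = q.1 := by
          rw [← hqp, hy]; ext; simp [Submodule.mem_colon_singleton]
        refine Kill.equiv (f.trans ((Submodule.quotEquivOfEq _ _ hk.symm).trans
          (LinearMap.quotKerEquivRange _))) ?_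
        exact Kill.down (Submodule.injective_subtype _) (Submodule.mkQ_surjective _)
          (LinearMap.exact_iff.2 (by simp)) (hl' i) (h l hl hl')
      · obtain ⟨a, ha, hap⟩ := Set.not_subset.1 hq
        refine ⟨a, hap, fun l hl _ => Kill.equiv f (Kill.of_smul fun m => ?_)⟩
        obtain ⟨m, rfl⟩ := Submodule.Quotient.mk_surjective _ m
        rw [← Submodule.Quotient.mk_smul, Submodule.Quotient.mk_eq_zero]
        exact q.1.mul_mem_right _ ha
    | exact N₁ N₂ N₃ f g hf hg hfg h₁ h₃ =>
      obtain ⟨a, ha, ha'⟩ := h₁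
      obtain ⟨b, hb, hb'⟩ := h₃
      exact ⟨a * b, hpp.mul_notMem ha hb,
        fun l hl hl' => Kill.ext hf hg hfg (ha' l hl hl') (hb' l hl hl')⟩

lemma unif_ann' (p : Ideal R) (hp : p ∈ minimalPrimes R) (d : ℕ)
    (M : Type) [AddCommGroup M] [Module R M] [Module.Finite R M] :
    ∃ a, a ∉ p ∧ ∀ l : List R, l.length = d → Acyc l R → ∀ i, Kill l a i M := by
  have hpp : p.IsPrime := hp.1.1
  have key : ∀ n, ∃ a, a ∉ p ∧ ∀ l : List R, l.length = d → Acyc l R → ∀ i < n, Kill l a i M := by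
    intro n
    induction n with
    | zero => exact ⟨1, (Ideal.ne_top_iff_one p).1 hpp.ne_top, by simp⟩
    | succ n ih =>
      obtain ⟨a, ha, ha'⟩ := ih
      obtain ⟨b, hb, hb'⟩ := unif_ann p hp d d n (by omega) M
      refine ⟨a * b, hpp.mul_notMem ha hb, fun l hl hl' i hi => ?_⟩
      rcases Nat.lt_succ_iff_lt_or_eq.1 hi with h | rfl
      · rw [mul_comm]; exact (ha' l hl hl' i h).mul b
      · exact (hb' l hl hl').mul a
  obtain ⟨a, ha, h⟩ := key d
  refine ⟨a, ha, fun l hl hl' i => ?_⟩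
  by_cases hi : i < d
  · exact h l hl hl' i hi
  · exact Kill.of_length (by omega)

end Ann

section Ball
variable {R : Type} [CommRing R] {l : List R} {c : R}

lemma kill_syz (hl : Acyc l R) {N M : ModuleCat.{0} R} (h : IsSyzygy R N M)
    (hM : ∀ i, Kill l c i M) (i : ℕ) : Kill l c i N := by
  obtain ⟨P, f, ⟨h1, h2⟩, hf, ⟨e⟩⟩ := h
  exact Kill.equiv e (Kill.down (Submodule.injective_subtype _) hf
    (LinearMap.exact_iff.2 (by simp)) (hl.proj P i) (hM (i + 1)))

lemma kill_nsyz (hl : Acyc l R) (n : ℕ) {N M : ModuleCat.{0} R} (h : IsNthSyzygy R n N M)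
    (hM : ∀ i, Kill l c i M) : ∀ i, Kill l c i N := by
  induction n generalizing N with
  | zero =>
    obtain ⟨e⟩ := h
    exact fun i => Kill.equiv e (hM i)
  | succ n ih =>
    obtain ⟨K, h1, h2⟩ := h
    exact fun i => kill_syz hl h2 (ih h1) i

lemma kill_bracket (hl : Acyc l R) {Y : ModuleCat.{0} R → Prop}
    (hY : ∀ M, Y M → ∀ i, Kill l c i M) (M : ModuleCat.{0} R) (h : Bracket R Y M) (i : ℕ) :
    Kill l c i M := by
  obtain ⟨k, F, N, hF, ⟨e⟩⟩ := h
  have h1 : Kill l c i ((j : Fin k) → F j) := Kill.pi fun j => by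
    rcases hF j with ⟨h1, h2⟩ | ⟨M', n, hM', hs⟩
    · exact (hl.proj (F j) i).of_one c
    · exact kill_nsyz hl n hs (hY M' hM') i
  exact (Kill.equiv e h1).retract (LinearMap.inl R M N) (LinearMap.fst R M N) (fun m => rfl)

lemma kill_ball (hl : Acyc l R) (C : ModuleCat.{0} R) (hC : ∀ i, Kill l c i C) (n : ℕ) :
    ∀ M, Ball R C (n + 1) M → ∀ i, Kill l (c ^ (n + 1)) i M := by
  have hC' : ∀ M : ModuleCat.{0} R, Nonempty (M ≃ₗ[R] C) → ∀ i, Kill l c i M :=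
    fun M ⟨e⟩ i => Kill.equiv e (hC i)
  induction n with
  | zero =>
    intro M h i
    simpa using kill_bracket hl hC' M h i
  | succ n ih =>
    intro M h i
    refine kill_bracket hl ?_ M h i
    rintro M ⟨A, B, f, g, hA, hB, h1, h2, h3⟩ i
    rw [pow_succ]
    exact Kill.ext h1 h2 (LinearMap.exact_iff.2 h3) (ih A hA i) (kill_bracket hl hC' B hB i)

lemma kill_W (hl : Acyc l R) {X : ModuleCat.{0} R → Prop} (hX : ∀ M, X M → ∀ i, Kill l c i M)
    (t : ℕ) : ∀ M, W X t M → ∀ i, t ≤ i → Kill l c i M := by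
  induction t with
  | zero => exact fun M h i _ => hX M h i
  | succ t ih =>
    rintro M ⟨K, ⟨P, f, ⟨h1, h2⟩, hf, ⟨e⟩⟩, hK⟩ i hi
    obtain ⟨i, rfl⟩ : ∃ j, i = j + 1 := ⟨i - 1, by omega⟩
    exact Kill.up (Submodule.injective_subtype _) hf
      (LinearMap.exact_iff.2 (by simp)) (hl.proj P (i + 1))
      (Kill.equiv e.symm (ih K hK i (by omega)))

end Ball
end Pf

namespace Pf
set_option linter.unusedSectionVars false
open RingTheory.Sequence IsLocalRing

section Fin
variable {R : Type} [CommRing R] [IsNoetherianRing R] [IsLocalRing R]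
  {X : ModuleCat.{0} R → Prop}

/-- killed by a power of the maximal ideal -/
def FL (M : Type) [AddCommGroup M] [Module R M] : Prop :=
  ∃ N : ℕ, ∀ r ∈ maximalIdeal R ^ N, ∀ m : M, r • m = 0

lemma fl_in (hX : Resolving R X) (hk : In X (ResidueField R)) (M : Type) [AddCommGroup M]
    [Module R M] [hM : Module.Finite R M] (h : FL (R := R) M) : In X M := by
  induction hM using IsNoetherianRing.induction_on_isQuotientEquivQuotientPrime R with
  | subsingleton N => exact r_zero hX
  | quotient N q f =>
    obtain ⟨n, hn⟩ := h
    have h1 : maximalIdeal R ^ n ≤ q.1 := fun r hr => by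
      have := hn r hr (f.symm (Submodule.Quotient.mk 1))
      rw [← map_smul, LinearEquiv.map_eq_zero_iff, ← Submodule.Quotient.mk_smul,
        Submodule.Quotient.mk_eq_zero] at this
      simpa using this
    have h2 : q.1 = maximalIdeal R :=
      le_antisymm (le_maximalIdeal q.2.ne_top) (q.2.le_of_pow_le h1)
    exact r_iso (A := R ⧸ maximalIdeal R) hX
      ((Submodule.quotEquivOfEq _ _ h2.symm).trans f.symm) hk
  | exact N₁ N₂ N₃ f g hf hg hfg h₁ h₃ =>
    obtain ⟨n, hn⟩ := h
    refine r_ext hX hf hg hfg (h₁ ⟨n, fun r hr m => hf ?_⟩) (h₃ ⟨n, fun r hr m => ?_⟩)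
    · rw [map_smul, hn r hr, map_zero]
    · obtain ⟨m, rfl⟩ := hg m
      rw [← map_smul, hn r hr, map_zero]

lemma exists_socle (M : Type) [AddCommGroup M] [Module R M] [Nontrivial M]
    (h : FL (R := R) M) : ∃ v : M, v ≠ 0 ∧ ∀ r ∈ maximalIdeal R, r • v = 0 := by
  obtain ⟨n, hn⟩ := h
  induction n with
  | zero =>
    obtain ⟨v, hv⟩ := exists_ne (0 : M)
    exact absurd (by simpa using hn 1 (by simp) v) hv
  | succ n ih =>
    by_cases hc : ∀ r ∈ maximalIdeal R ^ n, ∀ m : M, r • m = 0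
    · exact ih hc
    · push Not at hc
      obtain ⟨r, hr, m, hm⟩ := hc
      refine ⟨r • m, hm, fun x hx => ?_⟩
      rw [smul_smul]
      refine hn _ ?_ m
      rw [pow_succ']
      exact Ideal.mul_mem_mul hx hr

lemma descend (hX : Resolving R X) (A : Type) [AddCommGroup A] [Module R A] [Module.Finite R A]
    [Nontrivial A] (h : FL (R := R) A) (hA : In X A) (hk : In (Up X) (ResidueField R)) :
    In X (ResidueField R) := by
  obtain ⟨v, hv, hv'⟩ := exists_socle (R := R) A h
  let f := LinearMap.toSpanSingleton R A v
  have hf : LinearMap.ker f = maximalIdeal R := by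
    refine le_antisymm (le_maximalIdeal ?_) (fun r hr => hv' r hr)
    rw [Ideal.ne_top_iff_one]
    simpa [f] using hv
  have h1 : In (Up X) (A ⧸ LinearMap.range f) := by
    refine fl_in (up_resolving hX) hk _ ?_
    obtain ⟨n, hn⟩ := h
    refine ⟨n, fun r hr m => ?_⟩
    obtain ⟨m, rfl⟩ := Submodule.Quotient.mk_surjective _ m
    rw [← Submodule.Quotient.mk_smul, hn r hr, Submodule.Quotient.mk_zero]
  have h2 := up_sub hX _ hA h1
  exact r_iso (B := R ⧸ maximalIdeal R) hX (f.quotKerEquivRange.symm.trans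
    (Submodule.quotEquivOfEq _ _ hf)) h2

lemma W_quot (hX : Resolving R X) (rs : List R) (s : ℕ) (M : Type) [AddCommGroup M]
    [Module R M] (h : IsWeaklyRegular M rs) (hM : In (W X s) M) :
    In (W X (s + rs.length)) (M ⧸ (Ideal.ofList rs • ⊤ : Submodule R M)) := by
  induction rs generalizing M s with
  | nil =>
    exact r_iso (W_res hX s) (Submodule.quotEquivOfEqBot _ (by simp)).symm hM
  | cons x rs ih =>
    rw [isWeaklyRegular_cons_iff] at h
    have h1 : In (W X (s + 1)) (QuotSMulTop x M) := by
      refine up_quot (W_res hX s) _ ?_ (W_mono hX (Nat.le_succ s) hM)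
      refine r_iso (W_res hX s) ((LinearEquiv.ofInjective (LinearMap.lsmul R M x) h.1).trans
        (LinearEquiv.ofEq _ _ ?_)) hM
      ext m
      simp [Submodule.mem_smul_pointwise_iff_exists]
    have h2 := ih (s + 1) _ h.2 h1
    have h3 := r_iso (W_res hX _) (Submodule.quotOfListConsSMulTopEquivQuotSMulTopInner M x rs).symm h2
    rw [List.length_cons, show s + (rs.length + 1) = s + 1 + rs.length by omega]
    exact h3

lemma cancel_aux (x : WithBot ℕ∞) (d : ℕ) (h : x + d = d) : x = 0 := by
  induction x using WithBot.recBotCoe with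
  | bot => simp at h
  | coe x =>
    have h' : x + d = d := by exact_mod_cast h
    have : x = 0 := by
      induction x using ENat.recTopCoe with
      | top => simp at h'
      | coe x =>
        have h2 : x + d = d := by exact_mod_cast h'
        have : x = 0 := by omega
        simp [this]
    simp [this]

lemma max_le_radical {d : ℕ} (hdim : ringKrullDim R = (d : ℕ)) (rs : List R) (hd : rs.length = d)
    (hm : ∀ x ∈ rs, x ∈ maximalIdeal R) (h : IsWeaklyRegular R rs) :
    maximalIdeal R ≤ (Ideal.ofList rs).radical := by
  have h1 := ringKrullDim_add_length_eq_ringKrullDim_of_isRegular rs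
    (IsRegular.of_isWeaklyRegular_of_mem_maximalIdeal R hm h)
  have hne : Ideal.ofList rs ≤ maximalIdeal R := Ideal.span_le.2 hm
  have hnt : Nontrivial (R ⧸ Ideal.ofList rs) :=
    Ideal.Quotient.nontrivial_iff.2 (fun hh => (maximalIdeal.isMaximal R).ne_top
      (top_le_iff.1 (hh ▸ hne)))
  have h0 : ringKrullDim (R ⧸ Ideal.ofList rs) = 0 := by
    rw [hdim, hd] at h1
    exact cancel_aux _ d h1
  have h2 : Ring.KrullDimLE 0 (R ⧸ Ideal.ofList rs) := 
    ringKrullDimZero_iff_ringKrullDim_eq_zero.2 h0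
  rw [Ideal.krullDimLE_zero_quotient_iff_forall_minimalPrimes_isMaximal] at h2
  rw [← Ideal.sInf_minimalPrimes]
  refine le_sInf fun J hJ => ?_
  rw [eq_maximalIdeal (h2 J hJ)]

lemma fl_of_pow {rs : List R} (hr : maximalIdeal R ≤ (Ideal.ofList rs).radical)
    (M : Type) [AddCommGroup M] [Module R M] (h : ∀ y ∈ rs, ∃ n : ℕ, ∀ m : M, (y ^ n) • m = 0) :
    FL (R := R) M := by
  have h1 : Ideal.ofList rs ≤ (Module.annihilator R M).radical := Ideal.span_le.2 fun y hy => by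
    obtain ⟨n, hn⟩ := h y hy
    exact ⟨n, Module.mem_annihilator.2 hn⟩
  have h2 := hr.trans ((Ideal.radical_mono h1).trans (Ideal.radical_idem _).le)
  obtain ⟨n, hn⟩ := Ideal.exists_pow_le_of_le_radical_of_fg h2 (IsNoetherian.noetherian _)
  exact ⟨n, fun r hr => Module.mem_annihilator.1 (hn hr)⟩

lemma k_in_Wd (hX : Resolving R X) {d : ℕ} (hdim : ringKrullDim R = (d : ℕ)) (rs : List R)
    (hd : rs.length = d)
    (hm : ∀ x ∈ rs, x ∈ maximalIdeal R) (h : IsWeaklyRegular R rs) (n : ℕ)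
    (hk : In (W X n) (ResidueField R)) : In (W X d) (ResidueField R) := by
  have hR : In (W X 0) R := r_proj hX
  have hA := W_quot hX rs 0 R h hR
  rw [zero_add, hd] at hA
  have hnt := (IsRegular.of_isWeaklyRegular_of_mem_maximalIdeal R hm h).2
  have : Nontrivial (R ⧸ (Ideal.ofList rs • ⊤ : Submodule R R)) :=
    Submodule.Quotient.nontrivial_iff.2 hnt.symm
  have hfl : FL (R := R) (R ⧸ (Ideal.ofList rs • ⊤ : Submodule R R)) := by
    refine fl_of_pow (max_le_radical hdim rs hd hm h) _ fun y hy => ⟨1, fun m => ?_⟩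
    obtain ⟨m, rfl⟩ := Submodule.Quotient.mk_surjective _ m
    rw [← Submodule.Quotient.mk_smul, Submodule.Quotient.mk_eq_zero, pow_one]
    exact Submodule.smul_mem_smul (Ideal.subset_span hy) trivial
  have key : ∀ e, In (W X (d + e)) (ResidueField R) → In (W X d) (ResidueField R) := by
    intro e
    induction e with
    | zero => exact id
    | succ e ih =>
      intro h
      exact ih (descend (W_res hX _) _ hfl (W_mono hX (by omega) hA) h)
  exact key n (W_mono hX (by omega) hk)

end Fin

section Hom
variable {R : Type} [CommRing R] [IsNoetherianRing R] [IsLocalRing R]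
  {X : ModuleCat.{0} R → Prop}

lemma r_pi (hX : Resolving R X) {M : Type} [AddCommGroup M] [Module R M] (hM : In X M)
    (ι : Type) [Finite ι] : In X (ι → M) := by
  induction ι using Finite.induction_empty_option with
  | of_equiv e ih => exact r_iso hX (LinearEquiv.funCongrLeft R M e.symm) ih
  | h_empty => exact r_zero hX
  | h_option ih =>
    refine r_iso hX (LinearEquiv.piOptionEquivProd R).symm ?_
    exact r_ext hX (f := LinearMap.inl R _ _) (g := LinearMap.snd R _ _) LinearMap.inl_injective
      LinearMap.snd_surjective (Function.Exact.inl_snd) hM ih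

variable (l : List R) (M : Type) [AddCommGroup M] [Module R M]

/-- cycles -/
def Zm : (i : ℕ) → Submodule R (S l i → M)
  | 0 => ⊤
  | i + 1 => LinearMap.ker (dK M l i)

/-- boundaries -/
def Bm (i : ℕ) : Submodule R (S l i → M) := LinearMap.range (dK M l i)

/-- homology -/
abbrev Hm (i : ℕ) : Type := Zm l M i ⧸ (Bm l M i).submoduleOf (Zm l M i)

lemma B_le (i : ℕ) : Bm l M i ≤ Zm l M i := by
  cases i with
  | zero => exact le_top
  | succ i => rintro _ ⟨w, rfl⟩; exact dd l i w

variable {l M}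

lemma H_fl (hr : maximalIdeal R ≤ (Ideal.ofList l).radical) (i : ℕ) :
    FL (R := R) (Hm l M i) := by
  refine fl_of_pow hr _ fun y hy => ?_
  obtain ⟨n, h0, h1⟩ := kill_pow (M := M) l y hy
  refine ⟨n, fun m => ?_⟩
  obtain ⟨⟨z, hz⟩, rfl⟩ := Submodule.Quotient.mk_surjective _ m
  rw [← Submodule.Quotient.mk_smul, Submodule.Quotient.mk_eq_zero]
  change y ^ n • z ∈ Bm l M i
  cases i with
  | zero => exact h0 z
  | succ i => exact h1 i z hz

lemma Z_in (hX : Resolving R X) (hr : maximalIdeal R ≤ (Ideal.ofList l).radical) (hM : In X M)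
    (D : ℕ) (hk : In (W X (D + 1)) (ResidueField R)) (i : ℕ) : In (W X D) (Zm l M i) := by
  have hK : ∀ i, In (W X D) (S l i → M) := fun i => W_mono hX (Nat.zero_le D) (r_pi (X := W X 0) hX hM _)
  have hfin : Module.Finite R M := hX.fg _ hM
  induction i with
  | zero => exact r_iso (W_res hX D) (Submodule.topEquiv (R := R)).symm (hK 0)
  | succ i ih =>
    have h1 : In (W X (D + 1)) (Hm l M i) := fl_in (W_res hX (D + 1)) hk _ (H_fl hr i)
    have h2 := up_sub (W_res hX D) _ ih h1
    have h3 : In (W X D) (Bm l M i) :=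
      r_iso (W_res hX D) (Submodule.submoduleOfEquivOfLe (B_le l M i)) h2
    have h4 := r_ker_surj (W_res hX D) (LinearMap.surjective_rangeRestrict (dK M l i)) (hK (i + 1)) h3
    exact r_iso (W_res hX D) (LinearEquiv.ofEq _ _ (LinearMap.ker_rangeRestrict _)) h4

lemma B_in (hX : Resolving R X) (hM : In X M) (D : ℕ) (hl : l.length = D + 1) (t : ℕ)
    (hac : ∀ i, t < i → Kill l 1 i M) (e : ℕ) : ∀ i, t < i → D ≤ e + i →
      In (W X e) (Bm l M i) := by
  have hK : ∀ e i, In (W X e) (S l i → M) := fun e i =>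
    W_mono hX (Nat.zero_le e) (r_pi (X := W X 0) hX hM _)
  have hZB : ∀ i, t < i → LinearMap.ker (dK M l i) = Bm l M (i + 1) := fun i hi =>
    le_antisymm (fun z hz => by
      obtain ⟨w, hw⟩ := hac i hi z hz
      exact ⟨w, by simpa using hw⟩) (B_le l M (i + 1))
  induction e with
  | zero =>
    intro i hi hD
    have := emptyS l (i + 2) (by omega)
    have h0 : LinearMap.ker (dK M l i) = ⊥ := by
      rw [hZB i hi, eq_bot_iff]
      rintro _ ⟨w, rfl⟩
      rw [Subsingleton.elim w 0, map_zero]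
      exact zero_mem _
    exact r_iso (W_res hX 0) (LinearEquiv.ofInjective _ (LinearMap.ker_eq_bot.1 h0)) (hK 0 (i + 1))
  | succ e ih =>
    intro i hi hD
    have h1 := ih (i + 1) (by omega) (by omega)
    rw [← hZB i hi] at h1
    exact r_iso (W_res hX (e + 1)) (dK M l i).quotKerEquivRange
      (up_quot (W_res hX e) _ h1 (hK (e + 1) _))

lemma k_in_WD (hX : Resolving R X) (hr : maximalIdeal R ≤ (Ideal.ofList l).radical) (hM : In X M)
    (D : ℕ) (hl : l.length = D + 1) (hk : In (W X (D + 1)) (ResidueField R))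
    (hna : ¬ Acyc l M) : In (W X D) (ResidueField R) := by
  have hfin : Module.Finite R M := hX.fg _ hM
  obtain ⟨t, ht, hac⟩ : ∃ t, ¬ Kill l 1 t M ∧ ∀ i, t < i → Kill l 1 i M := by
    by_contra hc
    push Not at hc
    apply hna
    have key : ∀ e i, D + 1 ≤ i + e → Kill l 1 i M := by
      intro e
      induction e with
      | zero => exact fun i hi => Kill.of_length (by omega)
      | succ e ih =>
        intro i hi
        by_contra hcc
        obtain ⟨j, hj, hj'⟩ := hc i hcc
        exact hj' (ih j (by omega))
    exact fun i => key (D + 1) i (by omega)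
  have htD : t < D + 1 := by
    by_contra hc
    exact ht (Kill.of_length (by omega))
  have hH : In (W X D) (Hm l M (t + 1)) := by
    have hZ := Z_in hX hr hM D hk (t + 1)
    cases D with
    | zero =>
      have := emptyS l (t + 2) (by omega)
      have h0 : (Bm l M (t + 1)).submoduleOf (Zm l M (t + 1)) = ⊥ := by
        rw [eq_bot_iff]
        rintro ⟨z, hz⟩ ⟨w, hw⟩
        rw [Subsingleton.elim w 0, map_zero] at hw
        exact Subtype.ext hw.symm
      exact r_iso (W_res hX 0) (Submodule.quotEquivOfEqBot _ h0).symm hZ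
    | succ D =>
      refine up_quot (W_res hX D) _ ?_ hZ
      exact r_iso (W_res hX D) (Submodule.submoduleOfEquivOfLe (B_le l M _)).symm
        (B_in hX hM (D + 1) hl t hac D (t + 1) (by omega) (by omega))
  have hnt : Nontrivial (Hm l M (t + 1)) := by
    rw [Submodule.Quotient.nontrivial_iff]
    intro hc
    apply ht
    intro z hz
    have : (⟨z, hz⟩ : Zm l M (t + 1)) ∈ (Bm l M (t + 1)).submoduleOf (Zm l M (t + 1)) := by
      rw [hc]; trivial
    obtain ⟨w, hw⟩ := this
    exact ⟨w, by simpa using hw⟩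
  exact descend (W_res hX D) _ (H_fl hr (t + 1)) hH hk

end Hom
end Pf
/-- over a CM local ring, a resolving subcategory of finite radius
containing some syzygy of `k` consists of maximal Cohen–Macaulay modules. -/
theorem stmt9 (R : Type) [CommRing R] [IsNoetherianRing R] [IsLocalRing R] (d : ℕ)
    (hdim : ringKrullDim R = (d : ℕ)) (hCM : DepthGE R R d)
    (X : ModuleCat.{0} R → Prop) (hX : Resolving R X) (hrad : FiniteRadius R X)
    (n : ℕ)
    (hk : ∃ K, X K ∧ IsNthSyzygy R n K (ModuleCat.of R (IsLocalRing.ResidueField R))) :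
    ∀ M, X M → DepthGE R M d := by
  intro M hM
  obtain ⟨rs, hd, hm, hreg⟩ := hCM
  refine ⟨rs, hd, hm, ?_⟩
  have hfin : Module.Finite R M := hX.fg M hM
  by_contra hnr
  obtain ⟨D, rfl⟩ : ∃ D, d = D + 1 := by
    cases d with
    | zero =>
      rw [List.length_eq_zero_iff] at hd
      subst hd
      exact absurd (RingTheory.Sequence.IsWeaklyRegular.nil R M) hnr
    | succ D => exact ⟨D, rfl⟩
  obtain ⟨K, hK, hKs⟩ := hk
  have hk1 : Pf.In (Pf.W X n) (IsLocalRing.ResidueField R) := by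
    have := Pf.W_of_syz hX n K _ 0 hK hKs
    rwa [zero_add] at this
  have hk2 := Pf.k_in_Wd hX hdim rs hd hm hreg n hk1
  have hm' : ∀ x ∈ rs.reverse, x ∈ IsLocalRing.maximalIdeal R :=
    fun x hx => hm x (List.mem_reverse.1 hx)
  have hr : IsLocalRing.maximalIdeal R ≤ (Ideal.ofList rs.reverse).radical := by
    have h1 := Pf.max_le_radical hdim rs hd hm hreg
    have h2 : Ideal.ofList rs.reverse = Ideal.ofList rs := by simp [Ideal.ofList]
    rwa [h2]
  have hk3 := Pf.k_in_WD (M := M) hX hr hM D (by simpa using hd) hk2 (fun h => hnr (by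
    simpa using (Pf.acyc_iff _ hm').1 h))
  obtain ⟨p, hp⟩ :=
    (Ideal.nonempty_minimalPrimes (bot_ne_top : (⊥ : Ideal R) ≠ ⊤))
  have hpp : p.IsPrime := hp.1.1
  obtain ⟨C, r, hC, hball⟩ := hrad
  have hCfin : Module.Finite R C := hX.fg C hC
  obtain ⟨b, hb, hb'⟩ := Pf.unif_ann' p hp (D + 1) C
  have hmem : ∀ j, b ^ (r + 1) ∈ IsLocalRing.maximalIdeal R ^ j := by
    intro j
    have hmj : ∀ x ∈ rs.map (fun x => x ^ (j + 1)), x ∈ IsLocalRing.maximalIdeal R ^ j := by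
      intro x hx
      obtain ⟨y, hy, rfl⟩ := List.mem_map.1 hx
      exact Ideal.pow_le_pow_right (Nat.le_succ j) (Ideal.pow_mem_pow (hm y hy) _)
    have hmj' : ∀ x ∈ (rs.map (fun x => x ^ (j + 1))).reverse, x ∈ IsLocalRing.maximalIdeal R := by
      intro x hx
      obtain ⟨y, hy, rfl⟩ := List.mem_map.1 (List.mem_reverse.1 hx)
      exact Ideal.pow_mem_of_mem _ (hm y hy) _ (by omega)
    have hac : Pf.Acyc (rs.map (fun x => x ^ (j + 1))).reverse R := by
      rw [Pf.acyc_iff _ hmj', List.reverse_reverse]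
      exact Pf.wr_pow j rs hm hreg
    have hlen : (rs.map (fun x => x ^ (j + 1))).reverse.length = D + 1 := by simpa using hd
    have hkill := Pf.kill_W hac
      (fun M hM => Pf.kill_ball hac C (hb' _ hlen hac) r M (hball M hM)) D
      (ModuleCat.of R (R ⧸ IsLocalRing.maximalIdeal R ^ j))
      (Pf.fl_in (Pf.W_res hX D) hk3 _ ⟨j, fun x hx m => by
        obtain ⟨m, rfl⟩ := Submodule.Quotient.mk_surjective _ m
        rw [← Submodule.Quotient.mk_smul, Submodule.Quotient.mk_eq_zero]
        exact Ideal.mul_mem_right _ _ hx⟩) D le_rfl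
    have h1 := Pf.Kill.top (M := R ⧸ IsLocalRing.maximalIdeal R ^ j) hlen (fun x hx m => by
        obtain ⟨m, rfl⟩ := Submodule.Quotient.mk_surjective _ m
        rw [← Submodule.Quotient.mk_smul, Submodule.Quotient.mk_eq_zero]
        exact Ideal.mul_mem_right _ _ (hmj x (List.mem_reverse.1 hx))) hkill
      (Submodule.Quotient.mk 1)
    rw [← Submodule.Quotient.mk_smul, Submodule.Quotient.mk_eq_zero] at h1
    simpa using h1
  have hzero : b ^ (r + 1) ∈ (⊥ : Ideal R) := by
    rw [← Ideal.iInf_pow_eq_bot_of_isLocalRing _ (IsLocalRing.maximalIdeal.isMaximal R).ne_top]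
    exact (Submodule.mem_iInf _).2 hmem
  have hz : b ^ (r + 1) = 0 := by simpa using hzero
  exact hb (hpp.mem_of_pow_mem (r + 1) (hz ▸ p.zero_mem))
end
end

section
/- Let (R, m, k) be a Noetherian local ring and X a resolving subcategory of finitely generated R-modules. Suppose X contains a module M such that Ext^1_R(M, R) ≠ 0, ΩM is reflexive, and Ω^{-2}ΩM ∈ X. Then X contains a nonfree module of finite projective dimension; consequently the radius of X is infinite. -/
open CategoryTheory

noncomputable section

open Paper
theorem ext_vanish_aux (R : Type) [CommRing R] (M : ModuleCat.{0} R) (P : Type)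
    [AddCommGroup P] [Module R P] [Module.Projective R P] (f : P →ₗ[R] M)
    (hf : Function.Surjective f)
    (h : ∀ g : LinearMap.ker f →ₗ[R] R, ∃ G : P →ₗ[R] R, ∀ x : LinearMap.ker f, G x = g x) :
    ExtVanish R M (ModuleCat.of R R) 1 := by
  unfold ExtVanish
  let Q := projectiveResolution M
  suffices hz : Limits.IsZero ((Q.complex.linearYonedaObj R (ModuleCat.of R R)).homology 1) from
    ModuleCat.subsingleton_of_isZero (hz.of_iso (Q.isoExt 1 _))
  rw [← HomologicalComplex.exactAt_iff_isZero_homology,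
    HomologicalComplex.exactAt_iff' _ 0 1 2 (by simp) (by simp), ShortComplex.moduleCat_exact_iff]
  intro (φ : Q.complex.X 1 ⟶ ModuleCat.of R R) hφ
  have hφ' : Q.complex.d 2 1 ≫ φ = 0 := hφ
  -- the augmentation
  let p : (Q.complex.X 0) ⟶ M := Q.π.f 0
  have hp : Function.Surjective p.hom := (ModuleCat.epi_iff_surjective p).1 (by
    change Epi (Q.π.f 0); infer_instance)
  have hex0 := Q.isColimitCokernelCofork
  have hpd : Q.complex.d 1 0 ≫ p = 0 := Q.complex_d_comp_π_f_zero
  have hker0 : ∀ x : Q.complex.X 0, p.hom x = 0 → ∃ y, (Q.complex.d 1 0).hom y = x := by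
    have : (ShortComplex.mk _ _ hpd).Exact := ShortComplex.exact_of_g_is_cokernel _ hex0
    rw [ShortComplex.moduleCat_exact_iff] at this
    exact this
  have hker1 : ∀ x : Q.complex.X 1, (Q.complex.d 1 0).hom x = 0 →
      ∃ y, (Q.complex.d 2 1).hom y = x := by
    have := Q.exact_succ 0
    rw [ShortComplex.moduleCat_exact_iff] at this
    exact this
  have : Module.Projective R (Q.complex.X 0) :=
    (IsProjective.iff_projective (R := R) (Q.complex.X 0)).2 (Q.projective 0)
  obtain ⟨a, ha⟩ := Module.projective_lifting_property p.hom f hp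
  obtain ⟨b, hb⟩ := Module.projective_lifting_property f p.hom hf
  have ha' : ∀ x, p.hom (a x) = f x := fun x => LinearMap.congr_fun ha x
  have hb' : ∀ x, f (b x) = p.hom x := fun x => LinearMap.congr_fun hb x
  -- φ descends to the kernel of p
  let d := (Q.complex.d 1 0).hom
  have hdφ : LinearMap.ker d ≤ LinearMap.ker φ.hom := by
    intro x hx
    obtain ⟨y, rfl⟩ := hker1 x hx
    exact LinearMap.congr_fun (congrArg ModuleCat.Hom.hom hφ') y
  have hγ : ∀ x, p.hom x = 0 → x ∈ LinearMap.range d := fun x hx => hker0 x hx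
  let γ : LinearMap.range d →ₗ[R] R :=
    ((LinearMap.ker d).liftQ φ.hom hdφ) ∘ₗ d.quotKerEquivRange.symm.toLinearMap
  have hγd : ∀ x, γ ⟨d x, x, rfl⟩ = φ.hom x := by
    intro x
    have : d.quotKerEquivRange.symm ⟨d x, x, rfl⟩ = (LinearMap.ker d).mkQ x := by
      rw [LinearEquiv.symm_apply_eq]; rfl
    simp only [γ, LinearMap.comp_apply, LinearEquiv.coe_coe, this]
    rfl
  let aux1 : LinearMap.ker f →ₗ[R] LinearMap.range d :=
    (a ∘ₗ (LinearMap.ker f).subtype).codRestrict _ (fun x => hγ _ (by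
      rw [LinearMap.comp_apply, ha']; exact x.2))
  obtain ⟨G, hG⟩ := h (γ ∘ₗ aux1)
  let c : Q.complex.X 0 →ₗ[R] LinearMap.range d :=
    (a ∘ₗ b - LinearMap.id).codRestrict _ (fun x => hγ _ (by
      simp [ha', hb']))
  let Ψ : Q.complex.X 0 →ₗ[R] R := G ∘ₗ b - γ ∘ₗ c
  refine ⟨(ModuleCat.ofHom Ψ : Q.complex.X 0 ⟶ ModuleCat.of R R), ?_⟩
  change Q.complex.d 1 0 ≫ ModuleCat.ofHom Ψ = φ
  ext x
  change Ψ (d x) = φ.hom x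
  have hk : f (b (d x)) = 0 := by
    rw [hb']; exact LinearMap.congr_fun (congrArg ModuleCat.Hom.hom hpd) x
  have h1 : G (b (d x)) = γ (aux1 ⟨b (d x), hk⟩) := hG ⟨b (d x), hk⟩
  rw [← hγd x]
  change G (b (d x)) - γ (c (d x)) = _
  rw [h1, ← map_sub]
  congr 1
  ext
  simp [aux1, c]

/-- a system of bounded complexes of free modules (as functors of the coefficient module `E`),
with transition maps `θ a b` from level `a` to level `b ≤ a`. -/
structure KSys (R : Type) [CommRing R] where
  ι : ℕ → Type
  d : ℕ → (i : ℕ) → ∀ (E : Type) [AddCommGroup E] [Module R E], (ι (i+1) → E) →ₗ[R] (ι i → E)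
  θ : ℕ → ℕ → (i : ℕ) → ∀ (E : Type) [AddCommGroup E] [Module R E], (ι i → E) →ₗ[R] (ι i → E)
  d_nat : ∀ (N i : ℕ) (E F : Type) [AddCommGroup E] [Module R E] [AddCommGroup F] [Module R F]
    (f : E →ₗ[R] F) (z : ι (i+1) → E), d N i F (f ∘ z) = f ∘ d N i E z
  θ_nat : ∀ (a b i : ℕ) (E F : Type) [AddCommGroup E] [Module R E] [AddCommGroup F] [Module R F]
    (f : E →ₗ[R] F) (z : ι i → E), θ a b i F (f ∘ z) = f ∘ θ a b i E z
  dd : ∀ (N i : ℕ) (E : Type) [AddCommGroup E] [Module R E] (z : ι (i+2) → E),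
    d N i E (d N (i+1) E z) = 0
  θd : ∀ (a b i : ℕ), b ≤ a → ∀ (E : Type) [AddCommGroup E] [Module R E] (z : ι (i+1) → E),
    θ a b i E (d a i E z) = d b i E (θ a b (i+1) E z)
  θθ : ∀ (a b c i : ℕ), b ≤ a → c ≤ b → ∀ (E : Type) [AddCommGroup E] [Module R E] (z : ι i → E),
    θ b c i E (θ a b i E z) = θ a c i E z
  θ0 : ∀ (a b : ℕ) (E : Type) [AddCommGroup E] [Module R E] (z : ι 0 → E), θ a b 0 E z = z
  fin0 : Finite (ι 0)
  ne0 : Nonempty (ι 0)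

namespace KSys

variable {R : Type} [CommRing R] (S : KSys R)

/-- the transition map `a → b` is zero on homology in degree `i+1`, coefficients in `E`. -/
def PZ (E : Type) [AddCommGroup E] [Module R E] (i a b : ℕ) : Prop :=
  ∀ z : S.ι (i+1) → E, S.d a i E z = 0 → ∃ q : S.ι (i+2) → E, S.d b (i+1) E q = S.θ a b (i+1) E z

/-- pro-vanishing of the positive homology with finitely generated coefficients -/
def ProZero : Prop :=
  ∀ (E : Type) [AddCommGroup E] [Module R E] [Module.Finite R E] (i b : ℕ),
    ∃ a, b ≤ a ∧ S.PZ E i a b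

def Bdd (r : ℕ) : Prop := ∀ i, r < i → IsEmpty (S.ι i)

variable {S}

theorem PZ.mono {E : Type} [AddCommGroup E] [Module R E] {i a b a' b' : ℕ}
    (h : S.PZ E i a b) (hba : b ≤ a) (ha : a ≤ a') (hb : b' ≤ b) : S.PZ E i a' b' := by
  intro z hz
  obtain ⟨q, hq⟩ := h (S.θ a' a _ E z) (by rw [← S.θd _ _ _ ha, hz, map_zero])
  refine ⟨S.θ b b' _ E q, ?_⟩
  rw [← S.θd _ _ _ hb, hq, S.θθ _ _ _ _ ha hba, S.θθ _ _ _ _ (hba.trans ha) hb]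

theorem PZ.retract {E F : Type} [AddCommGroup E] [Module R E] [AddCommGroup F] [Module R F]
    {i a b : ℕ} (h : S.PZ E i a b) (s : F →ₗ[R] E) (p : E →ₗ[R] F) (hps : ∀ x, p (s x) = x) :
    S.PZ F i a b := by
  intro z hz
  obtain ⟨q, hq⟩ := h (s ∘ z) (by rw [S.d_nat, hz]; ext; simp)
  refine ⟨p ∘ q, ?_⟩
  rw [S.d_nat, hq, S.θ_nat]
  ext j
  simp [hps]

theorem PZ.pi {k : Type} {E : k → Type} [∀ j, AddCommGroup (E j)] [∀ j, Module R (E j)]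
    {i a b : ℕ} (h : ∀ j, S.PZ (E j) i a b) : S.PZ (∀ j, E j) i a b := by
  intro z hz
  have h1 : ∀ j, ∃ q : S.ι (i+2) → E j, S.d b (i+1) (E j) q =
      S.θ a b (i+1) (E j) ((LinearMap.proj (R := R) (φ := E) j) ∘ z) := fun j =>
    h j _ (by rw [S.d_nat, hz]; ext; simp)
  choose q hq using h1
  refine ⟨fun s j => q j s, ?_⟩
  ext s j
  have h2 := S.d_nat b (i+1) _ _ (LinearMap.proj (R := R) (φ := E) j) (fun s j => q j s)
  have h3 : ((LinearMap.proj (R := R) (φ := E) j) ∘ (fun s j => q j s)) = q j := rfl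
  rw [h3, hq, S.θ_nat] at h2
  exact (congrFun h2 s).symm

theorem exists_lift {ι E F : Type} [AddCommGroup E] [Module R E] [AddCommGroup F] [Module R F]
    (f : E →ₗ[R] F) (hf : Function.Surjective f) (z : ι → F) : ∃ y : ι → E, f ∘ y = z :=
  ⟨fun s => (hf (z s)).choose, funext fun s => (hf (z s)).choose_spec⟩

theorem exists_lift_ker {ι A E F : Type} [AddCommGroup A] [Module R A]
    [AddCommGroup E] [Module R E] [AddCommGroup F] [Module R F]
    (f : A →ₗ[R] E) (g : E →ₗ[R] F) (h : LinearMap.ker g = LinearMap.range f)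
    (z : ι → E) (hz : g ∘ z = 0) : ∃ y : ι → A, f ∘ y = z := by
  have : ∀ s, ∃ y, f y = z s := fun s => by
    have : z s ∈ LinearMap.ker g := congrFun hz s
    rw [h] at this
    exact this
  choose y hy using this
  exact ⟨y, funext hy⟩

theorem PZ.ext {A E B : Type} [AddCommGroup A] [Module R A]
    [AddCommGroup E] [Module R E] [AddCommGroup B] [Module R B]
    (f : A →ₗ[R] E) (g : E →ₗ[R] B) (hf : Function.Injective f) (hg : Function.Surjective g)
    (hfg : LinearMap.ker g = LinearMap.range f) {i a b c : ℕ} (hba : b ≤ a) (hcb : c ≤ b)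
    (hB : S.PZ B i a b) (hA : S.PZ A i b c) : S.PZ E i a c := by
  intro z hz
  obtain ⟨w', hw'⟩ := hB (g ∘ z) (by rw [S.d_nat, hz]; ext; simp)
  obtain ⟨w, rfl⟩ := exists_lift g hg w'
  rw [S.d_nat, S.θ_nat] at hw'
  obtain ⟨y, hy⟩ := exists_lift_ker f g hfg (S.θ a b (i+1) E z - S.d b (i+1) E w) (by
    ext s
    have := congrFun hw' s
    simp only [Function.comp_apply] at this
    simp [this])
  obtain ⟨q, hq⟩ := hA y (by
    have h1 := S.d_nat b i _ _ f y
    rw [hy, map_sub, S.dd, ← S.θd _ _ _ hba, hz, map_zero, sub_zero] at h1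
    ext s
    apply hf
    have := congrFun h1 s
    simpa using this.symm)
  refine ⟨f ∘ q + S.θ b c _ E w, ?_⟩
  rw [map_add, S.d_nat, hq, ← S.θ_nat, hy, map_sub, S.θθ _ _ _ _ hba hcb, S.θd _ _ _ hcb]
  abel

theorem PZ.syz {A E B : Type} [AddCommGroup A] [Module R A]
    [AddCommGroup E] [Module R E] [AddCommGroup B] [Module R B]
    (f : A →ₗ[R] E) (g : E →ₗ[R] B) (hf : Function.Injective f) (hg : Function.Surjective g)
    (hfg : LinearMap.ker g = LinearMap.range f) {i a b c : ℕ} (hba : b ≤ a) (hcb : c ≤ b)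
    (hE : S.PZ E i a b) (hB : S.PZ B (i+1) b c) : S.PZ A i a c := by
  intro z hz
  have hgf : ∀ x, g (f x) = 0 := fun x => by
    have : f x ∈ LinearMap.ker g := by rw [hfg]; exact ⟨x, rfl⟩
    exact this
  obtain ⟨w, hw⟩ := hE (f ∘ z) (by rw [S.d_nat, hz]; ext; simp)
  obtain ⟨y', hy'⟩ := hB (g ∘ w) (by
    rw [S.d_nat, hw, S.θ_nat]; ext; simp [hgf])
  obtain ⟨y, rfl⟩ := exists_lift g hg y'
  rw [S.d_nat, S.θ_nat] at hy'
  obtain ⟨q, hq⟩ := exists_lift_ker f g hfg (S.θ b c _ E w - S.d c _ E y) (by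
    ext s
    have := congrFun hy' s
    simp only [Function.comp_apply] at this
    simp [this])
  refine ⟨q, ?_⟩
  have h1 := S.d_nat c (i+1) _ _ f q
  rw [hq, map_sub, S.dd, ← S.θd _ _ _ hcb, hw, sub_zero, S.θθ _ _ _ _ hba hcb, S.θ_nat] at h1
  ext s
  apply hf
  exact (congrFun h1 s).symm

/-- the trivial system -/
def base (R : Type) [CommRing R] : KSys R where
  ι := fun i => match i with | 0 => Unit | _+1 => Empty
  d := fun _ _ _ => 0
  θ := fun _ _ _ _ => LinearMap.id
  d_nat := by intros; ext; simp
  θ_nat := by intros; rfl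
  dd := by intros; rfl
  θd := by intros; rfl
  θθ := by intros; rfl
  θ0 := by intros; rfl
  fin0 := inferInstanceAs (Finite Unit)
  ne0 := inferInstanceAs (Nonempty Unit)

/-- index types of the cone -/
def coneι (S : KSys R) : ℕ → Type
  | 0 => S.ι 0
  | i+1 => S.ι (i+1) ⊕ S.ι i

/-- degree zero part of the cone -/
def p0 (S : KSys R) (E : Type) [AddCommGroup E] [Module R E] :
    (coneι S 0 → E) →ₗ[R] (S.ι 0 → E) := LinearMap.id

/-- degree zero part of the cone -/
def m0 (S : KSys R) (E : Type) [AddCommGroup E] [Module R E] :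
    (S.ι 0 → E) →ₗ[R] (coneι S 0 → E) := LinearMap.id

/-- first component -/
def pL (S : KSys R) (i : ℕ) (E : Type) [AddCommGroup E] [Module R E] :
    (coneι S (i+1) → E) →ₗ[R] (S.ι (i+1) → E) :=
  LinearMap.funLeft R E (Sum.inl : S.ι (i+1) → S.ι (i+1) ⊕ S.ι i)

/-- second component -/
def pR (S : KSys R) (i : ℕ) (E : Type) [AddCommGroup E] [Module R E] :
    (coneι S (i+1) → E) →ₗ[R] (S.ι i → E) :=
  LinearMap.funLeft R E (Sum.inr : S.ι i → S.ι (i+1) ⊕ S.ι i)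

/-- pairing -/
def mkC (S : KSys R) (i : ℕ) (E : Type) [AddCommGroup E] [Module R E] :
    ((S.ι (i+1) → E) × (S.ι i → E)) →ₗ[R] (coneι S (i+1) → E) :=
  (LinearEquiv.sumArrowLequivProdArrow (S.ι (i+1)) (S.ι i) R E).symm.toLinearMap

section
variable {E : Type} [AddCommGroup E] [Module R E] {F : Type} [AddCommGroup F] [Module R F]

@[simp] theorem pL_mk (i : ℕ) (u) (w) : pL S i E (mkC S i E (u, w)) = u := rfl
@[simp] theorem pR_mk (i : ℕ) (u) (w) : pR S i E (mkC S i E (u, w)) = w := rfl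
@[simp] theorem p0_m0 (u) : p0 S E (m0 S E u) = u := rfl
@[simp] theorem m0_p0 (u) : m0 S E (p0 S E u) = u := rfl

theorem p0_comp (f : E →ₗ[R] F) (z) : p0 S F (f ∘ z) = f ∘ p0 S E z := rfl
theorem pL_comp (f : E →ₗ[R] F) (i : ℕ) (z) : pL S i F (f ∘ z) = f ∘ pL S i E z := rfl
theorem pR_comp (f : E →ₗ[R] F) (i : ℕ) (z) : pR S i F (f ∘ z) = f ∘ pR S i E z := rfl

theorem cone_ext0 {z z' : coneι S 0 → E} (h : p0 S E z = p0 S E z') : z = z' := h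

theorem cone_ext {i : ℕ} {z z' : coneι S (i+1) → E} (h1 : pL S i E z = pL S i E z')
    (h2 : pR S i E z = pR S i E z') : z = z' := by
  funext s
  rcases (s : S.ι (i+1) ⊕ S.ι i) with s | s
  · exact congrFun h1 s
  · exact congrFun h2 s

end

/-- differential of the cone of `y ^ N` -/
def coneD (S : KSys R) (y : R) (N : ℕ) : (i : ℕ) → ∀ (E : Type) [AddCommGroup E] [Module R E],
    (coneι S (i+1) → E) →ₗ[R] (coneι S i → E)
  | 0, E, _, _ => m0 S E ∘ₗ (S.d N 0 E ∘ₗ pL S 0 E + y ^ N • pR S 0 E)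
  | i+1, E, _, _ => mkC S i E ∘ₗ
      LinearMap.prod (S.d N (i+1) E ∘ₗ pL S (i+1) E + y ^ N • pR S (i+1) E)
        (- (S.d N i E ∘ₗ pR S (i+1) E))

/-- transition maps of the cone -/
def coneθ (S : KSys R) (y : R) (a b : ℕ) : (i : ℕ) → ∀ (E : Type) [AddCommGroup E] [Module R E],
    (coneι S i → E) →ₗ[R] (coneι S i → E)
  | 0, E, _, _ => m0 S E ∘ₗ S.θ a b 0 E ∘ₗ p0 S E
  | i+1, E, _, _ => mkC S i E ∘ₗ
      LinearMap.prod (S.θ a b (i+1) E ∘ₗ pL S i E) (y ^ (a - b) • (S.θ a b i E ∘ₗ pR S i E))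

section
variable {E : Type} [AddCommGroup E] [Module R E]

theorem coneD_zero (y : R) (N : ℕ) (z : coneι S (0+1) → E) :
    p0 S E (coneD S y N 0 E z) = S.d N 0 E (pL S 0 E z) + y ^ N • pR S 0 E z := rfl

theorem coneD_inl (y : R) (N i : ℕ) (z : coneι S (i+1+1) → E) :
    pL S i E (coneD S y N (i+1) E z) = S.d N (i+1) E (pL S (i+1) E z) + y ^ N • pR S (i+1) E z :=
  rfl

theorem coneD_inr (y : R) (N i : ℕ) (z : coneι S (i+1+1) → E) :
    pR S i E (coneD S y N (i+1) E z) = - S.d N i E (pR S (i+1) E z) := rfl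

theorem coneθ_zero (y : R) (a b : ℕ) (z : coneι S 0 → E) :
    p0 S E (coneθ S y a b 0 E z) = S.θ a b 0 E (p0 S E z) := rfl

theorem coneθ_inl (y : R) (a b i : ℕ) (z : coneι S (i+1) → E) :
    pL S i E (coneθ S y a b (i+1) E z) = S.θ a b (i+1) E (pL S i E z) := rfl

theorem coneθ_inr (y : R) (a b i : ℕ) (z : coneι S (i+1) → E) :
    pR S i E (coneθ S y a b (i+1) E z) = y ^ (a - b) • S.θ a b i E (pR S i E z) := rfl

end

/-- the cone -/
def cone (S : KSys R) (y : R) : KSys R where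
  ι := coneι S
  d := coneD S y
  θ := coneθ S y
  d_nat := by
    intro N i E F _ _ _ _ f z
    cases i with
    | zero =>
      apply cone_ext0
      rw [coneD_zero, p0_comp, coneD_zero, pL_comp, pR_comp, S.d_nat]
      ext s; simp
    | succ i =>
      apply cone_ext
      · rw [coneD_inl, pL_comp, pR_comp, pL_comp, coneD_inl, S.d_nat]
        ext s; simp
      · rw [coneD_inr, pR_comp, pR_comp, coneD_inr, S.d_nat]
        ext s; simp
  θ_nat := by
    intro a b i E F _ _ _ _ f z
    cases i with
    | zero => exact S.θ_nat _ _ _ _ _ f z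
    | succ i =>
      apply cone_ext
      · rw [coneθ_inl, pL_comp, pL_comp, coneθ_inl, S.θ_nat]
      · rw [coneθ_inr, pR_comp, pR_comp, coneθ_inr, S.θ_nat]
        ext s; simp
  dd := by
    intro N i E _ _ z
    cases i with
    | zero =>
      apply cone_ext0
      rw [coneD_zero, coneD_inl, coneD_inr, map_add, S.dd]; simp
    | succ i =>
      apply cone_ext
      · rw [coneD_inl, coneD_inl, coneD_inr, map_add, S.dd]; simp
      · rw [coneD_inr, coneD_inr, map_neg, S.dd]; simp
  θd := by
    intro a b i hba E _ _ z
    have hy : y ^ a = y ^ b * y ^ (a - b) := by rw [← pow_add]; congr 1; omega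
    cases i with
    | zero =>
      apply cone_ext0
      rw [coneD_zero, coneθ_zero, coneD_zero, coneθ_inl, coneθ_inr,
        map_add, S.θd _ _ _ hba, map_smul, smul_smul, hy]
    | succ i =>
      apply cone_ext
      · rw [coneθ_inl, coneD_inl, coneD_inl, coneθ_inl, coneθ_inr, map_add, S.θd _ _ _ hba,
          map_smul, smul_smul, hy]
      · rw [coneθ_inr, coneD_inr, coneD_inr, coneθ_inr, map_neg, S.θd _ _ _ hba, map_smul, smul_neg]
  θθ := by
    intro a b c i hba hcb E _ _ z
    cases i with
    | zero => exact S.θθ _ _ _ _ hba hcb _ _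
    | succ i =>
      apply cone_ext
      · rw [coneθ_inl, coneθ_inl, coneθ_inl, S.θθ _ _ _ _ hba hcb]
      · rw [coneθ_inr, coneθ_inr, coneθ_inr, map_smul, S.θθ _ _ _ _ hba hcb, smul_smul, ← pow_add]
        congr 2; omega
  θ0 := by
    intro a b E _ _ z
    exact S.θ0 _ _ _ _
  fin0 := S.fin0
  ne0 := S.ne0

theorem base_bdd : (base R).Bdd 0 := by
  intro i hi
  cases i with
  | zero => omega
  | succ i => exact inferInstanceAs (IsEmpty Empty)

theorem cone_bdd {r : ℕ} (h : S.Bdd r) (y : R) : (cone S y).Bdd (r+1) := by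
  intro i hi
  cases i with
  | zero => omega
  | succ i =>
    have := h (i+1) (by omega)
    have := h i (by omega)
    exact inferInstanceAs (IsEmpty (S.ι (i+1) ⊕ S.ι i))

theorem PZ.of_bdd {r : ℕ} (h : S.Bdd r) {E : Type} [AddCommGroup E] [Module R E] {i : ℕ}
    (hi : r ≤ i) (a b : ℕ) : S.PZ E i a b := by
  intro z hz
  have := h (i+1) (by omega)
  exact ⟨0, funext fun s => this.elim s⟩

theorem base_proZero : (base R).ProZero := fun _E _ _ _ _ b =>
  ⟨b, le_rfl, PZ.of_bdd base_bdd (Nat.zero_le _) _ _⟩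

theorem cone_PZ {E : Type} [AddCommGroup E] [Module R E] (y : R) {i a b c : ℕ} (hba : b ≤ a)
    (hcb : c ≤ b) (h1 : ∀ z : coneι S (i+1) → E, coneD S y a i E z = 0 →
      ∃ q, S.d b i E q = y ^ (a - b) • S.θ a b i E (pR S i E z))
    (h2 : S.PZ E i b c) : (cone S y).PZ E i a c := by
  intro (z : coneι S (i+1) → E) (hz : coneD S y a i E z = 0)
  change ∃ q : coneι S (i+1+1) → E, coneD S y c (i+1) E q = coneθ S y a c (i+1) E z
  obtain ⟨q, hq⟩ := h1 z hz
  have hy : y ^ a = y ^ b * y ^ (a - b) := by rw [← pow_add]; congr 1; omega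
  have hy2 : y ^ b = y ^ c * y ^ (b - c) := by rw [← pow_add]; congr 1; omega
  have hy3 : y ^ (a - c) = y ^ (b - c) * y ^ (a - b) := by rw [← pow_add]; congr 1; omega
  have hz1 : S.d a i E (pL S i E z) + y ^ a • (pR S i E z) = 0 := by
    cases i with
    | zero =>
      rw [← coneD_zero, hz, map_zero]
    | succ i =>
      rw [← coneD_inl, hz, map_zero]
  obtain ⟨p, hp⟩ := h2 (S.θ a b _ E (pL S i E z) + y ^ b • q) (by
    have := congrArg (S.θ a b i E) hz1
    rw [map_add, S.θd _ _ _ hba, map_smul, map_zero] at this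
    rw [map_add, map_smul, hq, smul_smul, ← hy, this])
  refine ⟨mkC S (i+1) E (p, - y ^ (b - c) • S.θ b c _ E q), ?_⟩
  apply cone_ext
  · rw [coneD_inl, coneθ_inl, pL_mk, pR_mk, hp, map_add, map_smul,
      S.θθ _ _ _ _ hba hcb, smul_smul, hy2]
    simp
  · rw [coneD_inr, coneθ_inr, pR_mk, map_smul, ← S.θd _ _ _ hcb, hq, map_smul,
      S.θθ _ _ _ _ hba hcb, hy3, smul_smul, neg_mul, neg_smul, neg_neg]

theorem cone_proZero [IsNoetherianRing R] (h : S.ProZero) (y : R) : (cone S y).ProZero := by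
  intro E _ _ _ i c
  obtain ⟨b, hcb, hb⟩ := h E i c
  cases i with
  | succ i =>
    obtain ⟨a, hba, ha⟩ := h E i b
    refine ⟨a, hcb.trans hba, cone_PZ y hba hcb ?_ hb⟩
    intro z hz
    obtain ⟨q, hq⟩ := ha (pR S (i+1) E z) (by
      have := coneD_inr y a i z
      rw [hz, map_zero] at this
      exact (neg_eq_zero.1 this.symm))
    exact ⟨y ^ (a - b) • q, by rw [map_smul, hq]⟩
  | zero =>
    have := S.fin0
    have : IsNoetherian R E := isNoetherian_of_isNoetherianRing_of_finite R E
    let Q := (S.ι 0 → E) ⧸ LinearMap.range (S.d b 0 E)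
    let φ : Module.End R Q := algebraMap R _ y
    obtain ⟨t, ht⟩ := monotone_stabilizes_iff_noetherian.2 (inferInstanceAs (IsNoetherian R Q))
      ⟨fun n => LinearMap.ker (φ ^ n), fun n m hnm x hx => by
        obtain ⟨k, rfl⟩ := Nat.exists_eq_add_of_le hnm
        rw [LinearMap.mem_ker] at hx ⊢
        rw [add_comm n k, pow_add, Module.End.mul_apply, hx, map_zero]⟩
    have hφ : ∀ n (x : S.ι 0 → E), Submodule.Quotient.mk x ∈ LinearMap.ker (φ ^ n) ↔
        ∃ q, S.d b 0 E q = y ^ n • x := by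
      intro n x
      rw [LinearMap.mem_ker, ← map_pow, Module.algebraMap_end_apply, ← Submodule.Quotient.mk_smul,
        Submodule.Quotient.mk_eq_zero, LinearMap.mem_range]
    refine ⟨b + t, by omega, cone_PZ (a := b + t) (b := b) y (by omega) hcb ?_ hb⟩
    intro z hz
    have h1 := coneD_zero y (b+t) z
    rw [hz, map_zero] at h1
    have h2 := congrArg (S.θ (b+t) b 0 E) h1.symm
    rw [map_add, S.θd _ _ _ (by omega), map_smul, map_zero] at h2
    have h3 : Submodule.Quotient.mk (S.θ (b+t) b 0 E (pR S 0 E z)) ∈ LinearMap.ker (φ ^ (b+t)) := by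
      rw [hφ]
      refine ⟨- S.θ (b+t) b (0+1) E (pL S 0 E z), ?_⟩
      rw [map_neg]
      exact neg_eq_of_add_eq_zero_right h2
    have h4 : LinearMap.ker (φ ^ t) = LinearMap.ker (φ ^ (b+t)) := ht (b+t) (by omega)
    rw [← h4, hφ] at h3
    simpa using h3

/-- the Koszul system on a list of elements -/
def kos (R : Type) [CommRing R] : List R → KSys R
  | [] => base R
  | y :: l => cone (kos R l) y

theorem kos_bdd (l : List R) : (kos R l).Bdd l.length := by
  induction l with
  | nil => exact base_bdd
  | cons y l ih => exact cone_bdd ih y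

theorem kos_proZero [IsNoetherianRing R] (l : List R) : (kos R l).ProZero := by
  induction l with
  | nil => exact base_proZero
  | cons y l ih => exact cone_proZero ih y

theorem kos_range_le (l : List R) (z) (s) :
    (kos R l).d 1 0 R z s ∈ Ideal.span {x | x ∈ l} := by
  induction l with
  | nil => change (0 : R) ∈ _; exact zero_mem _
  | cons y l ih =>
    have h1 : Ideal.span {x | x ∈ l} ≤ Ideal.span {x | x ∈ y :: l} :=
      Ideal.span_mono (fun x hx => List.mem_cons_of_mem _ hx)
    change (kos R l).d 1 0 R (pL (kos R l) 0 R z) s + y ^ 1 • pR (kos R l) 0 R z s ∈ _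
    refine add_mem (h1 (ih _ _)) ?_
    rw [pow_one, smul_eq_mul]
    exact Ideal.mul_mem_right _ _ (Ideal.subset_span List.mem_cons_self)

theorem le_kos_range (l : List R) (N : ℕ) (E : Type) [AddCommGroup E] [Module R E] (x : R)
    (hx : x ∈ l) (e : (kos R l).ι 0 → E) : x ^ N • e ∈ LinearMap.range ((kos R l).d N 0 E) := by
  induction l with
  | nil => simp at hx
  | cons y l ih =>
    rcases List.mem_cons.1 hx with rfl | hx
    · refine ⟨mkC (kos R l) 0 E (0, p0 _ E e), ?_⟩
      apply cone_ext0 (S := kos R l)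
      exact (coneD_zero _ _ _).trans (by rw [pL_mk, pR_mk, map_zero, zero_add]; rfl)
    · obtain ⟨q, hq⟩ := ih hx (p0 (kos R l) E e)
      refine ⟨mkC (kos R l) 0 E (q, 0), ?_⟩
      apply cone_ext0 (S := kos R l)
      exact (coneD_zero _ _ _).trans (by rw [pL_mk, pR_mk, smul_zero, add_zero, hq]; rfl)

theorem le_kos_range' (l : List R) (N : ℕ) (E : Type) [AddCommGroup E] [Module R E] (e : E)
    (he : e ∈ Ideal.span {x | ∃ y ∈ l, y ^ N = x} • (⊤ : Submodule R E)) :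
    (fun _ => e) ∈ LinearMap.range ((kos R l).d N 0 E) := by
  induction he using Submodule.smul_induction_on' with
  | smul r hr n hn =>
    induction hr using Submodule.span_induction with
    | mem r hr =>
      obtain ⟨y, hy, rfl⟩ := hr
      exact le_kos_range l N E y hy (fun _ => n)
    | zero => simp only [zero_smul]; exact zero_mem _
    | add r s _ _ h1 h2 => simp only [add_smul]; exact add_mem h1 h2
    | smul a r _ h => simp only [smul_eq_mul, mul_smul]; exact Submodule.smul_mem _ a h
  | add x _ y _ h1 h2 => exact add_mem h1 h2

end KSys

namespace KSys

variable {R : Type} [CommRing R] (S : KSys R)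

/-- uniform pro-vanishing on a class of modules -/
def Unif (Y : ModuleCat.{0} R → Prop) : Prop :=
  ∀ b : ℕ, ∃ a, b ≤ a ∧ ∀ E, Y E → ∀ i, S.PZ E i a b

variable {S}

theorem PZ.equiv {E F : Type} [AddCommGroup E] [Module R E] [AddCommGroup F] [Module R F]
    {i a b : ℕ} (h : S.PZ E i a b) (e : F ≃ₗ[R] E) : S.PZ F i a b :=
  h.retract e.toLinearMap e.symm.toLinearMap (by simp)

theorem unif_of_finite {r : ℕ} (hr : S.Bdd r) (hS : S.ProZero) (C : Type) [AddCommGroup C]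
    [Module R C] [Module.Finite R C] (b : ℕ) : ∃ a, b ≤ a ∧ ∀ i, S.PZ C i a b := by
  have h : ∀ k, ∃ a, b ≤ a ∧ ∀ i, i < k → S.PZ C i a b := by
    intro k
    induction k with
    | zero => exact ⟨b, le_rfl, by simp⟩
    | succ k ih =>
      obtain ⟨a, hba, ha⟩ := ih
      obtain ⟨a', hba', ha'⟩ := hS C k b
      refine ⟨max a a', by omega, fun i hi => ?_⟩
      rcases Nat.lt_succ_iff_lt_or_eq.1 hi with hi | rfl
      · exact (ha i hi).mono hba (le_max_left _ _) le_rfl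
      · exact ha'.mono hba' (le_max_right _ _) le_rfl
  obtain ⟨a, hba, ha⟩ := h r
  refine ⟨a, hba, fun i => ?_⟩
  by_cases hi : i < r
  · exact ha i hi
  · exact PZ.of_bdd hr (by omega) _ _

theorem unif_iso {r : ℕ} (hr : S.Bdd r) (hS : S.ProZero) (C : ModuleCat.{0} R)
    (hC : Module.Finite R C) : S.Unif (fun M => Nonempty (M ≃ₗ[R] C)) := by
  intro b
  obtain ⟨a, hba, ha⟩ := unif_of_finite hr hS C b
  exact ⟨a, hba, fun E ⟨e⟩ i => (ha i).equiv e⟩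

theorem unif_proj {r : ℕ} (hr : S.Bdd r) (hS : S.ProZero) : S.Unif (FGProj R) := by
  intro b
  obtain ⟨a, hba, ha⟩ := unif_of_finite hr hS R b
  refine ⟨a, hba, fun E hE i => ?_⟩
  obtain ⟨h1, h2⟩ := hE
  obtain ⟨n, f, hf⟩ := Module.Finite.exists_fin' R E
  obtain ⟨s, hs⟩ := Module.projective_lifting_property f LinearMap.id hf
  exact (PZ.pi (fun _ : Fin n => ha i)).retract s f (fun x => LinearMap.congr_fun hs x)

theorem unif_or {Y Z : ModuleCat.{0} R → Prop} (hY : S.Unif Y) (hZ : S.Unif Z) :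
    S.Unif (fun M => Y M ∨ Z M) := by
  intro b
  obtain ⟨a, hba, ha⟩ := hY b
  obtain ⟨a', hba', ha'⟩ := hZ b
  refine ⟨max a a', by omega, fun E hE i => ?_⟩
  rcases hE with hE | hE
  · exact (ha E hE i).mono hba (le_max_left _ _) le_rfl
  · exact (ha' E hE i).mono hba' (le_max_right _ _) le_rfl

theorem unif_add {Y : ModuleCat.{0} R → Prop} (hY : S.Unif Y) : S.Unif (AddClosure R Y) := by
  intro b
  obtain ⟨a, hba, ha⟩ := hY b
  refine ⟨a, hba, fun E hE i => ?_⟩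
  obtain ⟨k, f, N, hf, ⟨e⟩⟩ := hE
  have h1 : S.PZ (E × N) i a b := (PZ.pi (fun j => ha (f j) (hf j) i)).equiv e
  exact h1.retract (LinearMap.inl R E N) (LinearMap.fst R E N) (fun x => rfl)

theorem unif_ext {Y Z : ModuleCat.{0} R → Prop} (hY : S.Unif Y) (hZ : S.Unif Z) :
    S.Unif (ExtOf R Y Z) := by
  intro c
  obtain ⟨b, hcb, hb⟩ := hY c
  obtain ⟨a, hba, ha⟩ := hZ b
  refine ⟨a, by omega, fun E hE i => ?_⟩
  obtain ⟨A, B, f, g, hA, hB, h1, h2, h3⟩ := hE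
  exact PZ.ext f g h1 h2 h3 hba hcb (ha B hB i) (hb A hA i)

theorem unif_syz {r : ℕ} (hr : S.Bdd r) (hS : S.ProZero) {Y : ModuleCat.{0} R → Prop}
    (hY : S.Unif Y) :
    S.Unif (fun N => ∃ (M : ModuleCat.{0} R) (i : ℕ), Y M ∧ IsNthSyzygy R i N M) := by
  have key : ∀ k b, ∃ a, b ≤ a ∧ ∀ (N M : ModuleCat.{0} R) (j : ℕ), Y M → IsNthSyzygy R j N M →
      ∀ i, r ≤ i + k → S.PZ N i a b := by
    intro k
    induction k with
    | zero =>
      intro b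
      exact ⟨b, le_rfl, fun N M j _ _ i hi => PZ.of_bdd hr (by omega) _ _⟩
    | succ k ih =>
      intro c
      obtain ⟨b, hcb, hb⟩ := ih c
      obtain ⟨a, hba, ha⟩ := unif_proj hr hS b
      obtain ⟨a', hca', ha'⟩ := hY c
      refine ⟨max a a', by omega, fun N M j hM hN i hi => ?_⟩
      cases j with
      | zero =>
        obtain ⟨e⟩ := hN
        exact ((ha' M hM i).equiv e).mono hca' (le_max_right _ _) le_rfl
      | succ j =>
        obtain ⟨K, hK, P, f, hP, hf, ⟨e⟩⟩ := hN
        have h2 : S.PZ N i a c := by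
          refine PZ.syz ((LinearMap.ker f).subtype ∘ₗ e.toLinearMap) f ?_ hf ?_ hba hcb (ha P hP i)
            (hb K M j hM hK (i+1) (by omega))
          · exact (Subtype.val_injective).comp e.injective
          · rw [LinearMap.range_comp]; simp
        exact h2.mono (by omega) (le_max_left _ _) le_rfl
  intro b
  obtain ⟨a, hba, ha⟩ := key r b
  refine ⟨a, hba, fun E hE i => ?_⟩
  obtain ⟨M, j, hM, hE⟩ := hE
  exact ha E M j hM hE i (by omega)

theorem unif_bracket {r : ℕ} (hr : S.Bdd r) (hS : S.ProZero) {Y : ModuleCat.{0} R → Prop}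
    (hY : S.Unif Y) : S.Unif (Bracket R Y) :=
  unif_add (unif_or (unif_proj hr hS) (unif_syz hr hS hY))

theorem unif_ball {r : ℕ} (hr : S.Bdd r) (hS : S.ProZero) (C : ModuleCat.{0} R)
    (hC : Module.Finite R C) (n : ℕ) : S.Unif (Ball R C (n+1)) := by
  induction n with
  | zero => exact unif_bracket hr hS (unif_iso hr hS C hC)
  | succ n ih =>
    exact unif_bracket hr hS (unif_ext ih (unif_bracket hr hS (unif_iso hr hS C hC)))

/-- non-vanishing of the transition map -/
theorem not_PZ (l : List R) (hl : Ideal.span {x | x ∈ l} ≠ ⊤) (a : ℕ) (ha : 1 ≤ a)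
    (Q : Type) [AddCommGroup Q] [Module R Q] (v : Q) (hv : ∀ r : R, r • v = 0 → r = 0)
    (hva : v ∈ Ideal.span {x | ∃ y ∈ l, y ^ a = x} • (⊤ : Submodule R Q)) :
    ¬ (kos R l).PZ (Q ⧸ Submodule.span R {v}) 0 a 1 := by
  intro h
  obtain ⟨z, hz⟩ := le_kos_range' l a Q v hva
  let p := (Submodule.span R {v}).mkQ
  have hp : Function.Surjective p := Submodule.mkQ_surjective _
  have hpv : p v = 0 := by simp [p]
  let f := LinearMap.toSpanSingleton R Q v
  have hfp : LinearMap.ker p = LinearMap.range f := by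
    rw [Submodule.ker_mkQ, LinearMap.range_toSpanSingleton]
  obtain ⟨y', hy'⟩ := h (p ∘ z) (by
    rw [(kos R l).d_nat, hz]; ext s; exact hpv)
  obtain ⟨y, rfl⟩ := exists_lift p hp y'
  rw [(kos R l).d_nat, (kos R l).θ_nat] at hy'
  obtain ⟨s, hs⟩ := exists_lift_ker f p hfp ((kos R l).θ a 1 _ Q z - (kos R l).d 1 _ Q y) (by
    ext s
    have := congrFun hy' s
    simp only [Function.comp_apply] at this
    simp [this])
  have h1 := (kos R l).d_nat 1 0 _ _ f s
  rw [hs, map_sub, (kos R l).dd, ← (kos R l).θd _ _ _ ha, hz, (kos R l).θ0, sub_zero] at h1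
  obtain ⟨t⟩ := (kos R l).ne0
  have h2 := congrFun h1 t
  have h3 : (1 - (kos R l).d 1 0 R s t) • v = 0 := by
    rw [sub_smul, one_smul, sub_eq_zero]; exact h2
  have h4 := hv _ h3
  apply hl
  rw [Ideal.eq_top_iff_one, sub_eq_zero.1 h4]
  exact kos_range_le l s t

end KSys

namespace ResAux

variable {R : Type} [CommRing R] {X : ModuleCat.{0} R → Prop}

theorem iso (hX : Resolving R X) {E F : Type} [AddCommGroup E] [Module R E]
    [AddCommGroup F] [Module R F] (e : E ≃ₗ[R] F) (h : X (ModuleCat.of R E)) :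
    X (ModuleCat.of R F) :=
  hX.summand (ModuleCat.of R E) (ModuleCat.of R F) (ModuleCat.of R PUnit) h
    ⟨e.trans ((LinearEquiv.prodUnique (R := R) (M := F) (M₂ := PUnit)).symm)⟩

theorem ext3 (hX : Resolving R X) {A B C : Type} [AddCommGroup A] [Module R A]
    [AddCommGroup B] [Module R B] [AddCommGroup C] [Module R C] (f : A →ₗ[R] B) (g : B →ₗ[R] C)
    (hf : Function.Injective f) (hg : Function.Surjective g)
    (hfg : LinearMap.ker g = LinearMap.range f) (hA : X (ModuleCat.of R A))
    (hC : X (ModuleCat.of R C)) : X (ModuleCat.of R B) :=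
  hX.extension (ModuleCat.of R A) (ModuleCat.of R B) (ModuleCat.of R C) f g
    ⟨hf, hg, hfg⟩ hA hC

theorem coker (hX : Resolving R X) {A B C : Type} [AddCommGroup A] [Module R A]
    [AddCommGroup B] [Module R B] [AddCommGroup C] [Module R C] (f : A →ₗ[R] B) (g : B →ₗ[R] C)
    (hg : Function.Surjective g)
    (hfg : LinearMap.ker g = LinearMap.range f)
    (hC : X (ModuleCat.of R C)) : X (ModuleCat.of R (B ⧸ LinearMap.range f)) :=
  iso hX (((Submodule.quotEquivOfEq _ _ hfg.symm).trans
    (g.quotKerEquivOfSurjective hg)).symm) hC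

theorem comp (hX : Resolving R X) {A B D : Type} [AddCommGroup A] [Module R A]
    [AddCommGroup B] [Module R B] [AddCommGroup D] [Module R D] (α : A →ₗ[R] B) (β : B →ₗ[R] D)
    (hβ : Function.Injective β) (h1 : X (ModuleCat.of R (B ⧸ LinearMap.range α)))
    (h2 : X (ModuleCat.of R (D ⧸ LinearMap.range β))) :
    X (ModuleCat.of R (D ⧸ LinearMap.range (β ∘ₗ α))) := by
  have hle : LinearMap.range α ≤ (LinearMap.range (β ∘ₗ α)).comap β := by
    rintro _ ⟨a, rfl⟩
    exact ⟨a, rfl⟩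
  have hle2 : LinearMap.range (β ∘ₗ α) ≤ LinearMap.range β := LinearMap.range_comp_le_range _ _
  refine ext3 hX (Submodule.mapQ _ _ β hle) (Submodule.factor hle2) ?_ ?_ ?_ h1 h2
  · rw [injective_iff_map_eq_zero]
    intro y
    obtain ⟨b, rfl⟩ := Submodule.Quotient.mk_surjective _ y
    rw [Submodule.mapQ_apply, Submodule.Quotient.mk_eq_zero, Submodule.Quotient.mk_eq_zero]
    rintro ⟨a, ha⟩
    exact ⟨a, hβ ha⟩
  · exact Submodule.factor_surjective hle2
  · ext y
    obtain ⟨d, rfl⟩ := Submodule.Quotient.mk_surjective _ y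
    rw [LinearMap.mem_ker]
    change (Submodule.Quotient.mk d : D ⧸ LinearMap.range β) = 0 ↔ _
    rw [Submodule.Quotient.mk_eq_zero]
    constructor
    · rintro ⟨b, rfl⟩
      exact ⟨Submodule.Quotient.mk b, rfl⟩
    · rintro ⟨z, hz⟩
      obtain ⟨b, rfl⟩ := Submodule.Quotient.mk_surjective _ z
      rw [Submodule.mapQ_apply, Submodule.Quotient.eq] at hz
      obtain ⟨a, ha⟩ := hz
      refine ⟨b - α a, ?_⟩
      rw [map_sub]
      rw [LinearMap.comp_apply] at ha
      rw [ha]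
      abel

theorem projX (hX : Resolving R X) (P : Type) [AddCommGroup P] [Module R P] [Module.Finite R P]
    [Module.Projective R P] : X (ModuleCat.of R P) :=
  hX.proj _ ⟨‹_›, ‹_›⟩

theorem prodX (hX : Resolving R X) {A B : Type} [AddCommGroup A] [Module R A]
    [AddCommGroup B] [Module R B] (hA : X (ModuleCat.of R A)) (hB : X (ModuleCat.of R B)) :
    X (ModuleCat.of R (A × B)) :=
  ext3 hX (LinearMap.inl R A B) (LinearMap.snd R A B) LinearMap.inl_injective
    LinearMap.snd_surjective (LinearMap.range_inl R A B).symm hA hB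

theorem powX (hX : Resolving R X) {A : Type} [AddCommGroup A] [Module R A]
    (hA : X (ModuleCat.of R A)) (m : ℕ) : X (ModuleCat.of R (Fin m → A)) := by
  induction m with
  | zero => exact hX.proj _ ⟨inferInstanceAs (Module.Finite R (Fin 0 → A)), inferInstanceAs (Module.Projective R (Fin 0 → A))⟩
  | succ m ih => exact iso hX (Fin.consLinearEquiv R (fun _ : Fin (m+1) => A)) (prodX hX hA ih)

/-- powers -/
theorem powers (hX : Resolving R X) {m : ℕ} (v : Fin m → R) (hv : ∀ r : R, r • v = 0 → r = 0)
    (hXv : X (ModuleCat.of R ((Fin m → R) ⧸ Submodule.span R {v}))) (k : ℕ) :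
    ∃ (Q : ModuleCat.{0} R) (w : Q), (∀ r : R, r • w = 0 → r = 0) ∧
      X (ModuleCat.of R (Q ⧸ Submodule.span R {w})) ∧
      w ∈ (Ideal.span {x | x ∈ List.ofFn v}) ^ k • (⊤ : Submodule R Q) := by
  induction k with
  | zero =>
    refine ⟨ModuleCat.of R R, (1 : R), ?_, ?_, ?_⟩
    · intro r hr
      change r * 1 = 0 at hr
      simpa using hr
    · have h : Submodule.span R {(1 : R)} = ⊤ := Ideal.span_singleton_one
      have : Subsingleton (R ⧸ Submodule.span R {(1 : R)}) :=
        Submodule.Quotient.subsingleton_iff.2 h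
      exact projX hX (R ⧸ Submodule.span R {(1 : R)})
    · simp
  | succ k ih =>
    obtain ⟨Q, w, hw, hXw, hwk⟩ := ih
    let β : (Fin m → R) →ₗ[R] (Fin m → Q) :=
      LinearMap.pi fun j => (LinearMap.toSpanSingleton R Q w) ∘ₗ LinearMap.proj j
    have hβ : ∀ r j, β r j = r j • w := fun r j => rfl
    let α : R →ₗ[R] (Fin m → R) := LinearMap.toSpanSingleton R _ v
    have hα : LinearMap.range α = Submodule.span R {v} :=
      LinearMap.range_toSpanSingleton v
    let w' : Fin m → Q := fun j => v j • w
    have hβα : LinearMap.range (β ∘ₗ α) = Submodule.span R {w'} := by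
      rw [LinearMap.range_comp, hα, Submodule.map_span, Set.image_singleton]
      rfl
    refine ⟨ModuleCat.of R (Fin m → Q), w', ?_, ?_, ?_⟩
    · intro r hr
      apply hv
      funext j
      have := congrFun hr j
      change r • v j • w = 0 at this
      rw [smul_smul] at this
      exact hw _ this
    · have key := comp hX α β ?_ ?_ ?_
      · rw [hβα] at key
        exact key
      · rw [injective_iff_map_eq_zero]
        intro r hr
        funext j
        exact hw _ (congrFun hr j)
      · rw [hα]; exact hXv
      · let ρ : (Fin m → Q) →ₗ[R] (Fin m → Q ⧸ Submodule.span R {w}) :=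
          LinearMap.pi fun j => (Submodule.mkQ _) ∘ₗ LinearMap.proj j
        refine coker hX β ρ ?_ ?_ (powX hX hXw m)
        · intro y
          choose z hz using fun j => Submodule.Quotient.mk_surjective _ (y j)
          exact ⟨z, funext hz⟩
        · ext z
          rw [LinearMap.mem_ker]
          constructor
          · intro hz
            have : ∀ j, ∃ r : R, r • w = z j := by
              intro j
              have := congrFun hz j
              change (Submodule.Quotient.mk (z j) : Q ⧸ Submodule.span R {w}) = 0 at this
              rw [Submodule.Quotient.mk_eq_zero, Submodule.mem_span_singleton] at this
              exact this
            choose r hr using this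
            exact ⟨r, funext hr⟩
          · rintro ⟨r, rfl⟩
            funext j
            change (Submodule.Quotient.mk (r j • w) : Q ⧸ Submodule.span R {w}) = 0
            rw [Submodule.Quotient.mk_eq_zero, Submodule.mem_span_singleton]
            exact ⟨_, rfl⟩
    · have h1 : w' = ∑ j, v j • (LinearMap.single R (fun _ : Fin m => Q) j w) := by
        funext i
        simp [w', Finset.sum_apply, Pi.single_apply]
      rw [h1, pow_succ', Submodule.mul_smul]
      refine Submodule.sum_mem _ fun j _ => ?_
      refine Submodule.smul_mem_smul (Ideal.subset_span ?_) ?_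
      · simp [List.mem_ofFn]
      · have h2 := Submodule.mem_map_of_mem (f := LinearMap.single R (fun _ : Fin m => Q) j) hwk
        rw [Submodule.map_smul''] at h2
        exact Submodule.smul_mono le_rfl le_top h2

/-- reduction to rank one -/
theorem rank_one [IsLocalRing R] (hX : Resolving R X) (n : ℕ) :
    ∀ (Q V : Type) [AddCommGroup Q] [Module R Q] [AddCommGroup V] [Module R V]
      [Module.Finite R Q] [Module.Projective R Q] (φ : (Fin n → R) →ₗ[R] Q) (π : Q →ₗ[R] V),
      Function.Injective φ → Function.Surjective π → LinearMap.ker π = LinearMap.range φ →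
      X (ModuleCat.of R V) → ¬ Module.Projective R V →
      ∃ (m : ℕ) (v : Fin m → R), (∀ r : R, r • v = 0 → r = 0) ∧
        X (ModuleCat.of R ((Fin m → R) ⧸ Submodule.span R {v})) ∧
        ∀ j, v j ∈ IsLocalRing.maximalIdeal R := by
  induction n with
  | zero =>
    intro Q V _ _ _ _ _ _ φ π hφ hπ hk hV hP
    exfalso
    apply hP
    have hinj : Function.Injective π := by
      rw [← LinearMap.ker_eq_bot, hk, LinearMap.range_eq_bot]
      ext i
      exact i.elim0
    exact Module.Projective.of_equiv (LinearEquiv.ofBijective π ⟨hinj, hπ⟩)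
  | succ n ih =>
    intro Q V _ _ _ _ _ _ φ π hφ hπ hk hV hP
    let c := Fin.consLinearEquiv R (fun _ : Fin (n+1) => R)
    let w : Q := φ (c (1, 0))
    have hc : ∀ (r : R) (u : Fin n → R), φ (c (r, u)) = r • w + φ (c (0, u)) := by
      intro r u
      rw [← map_smul, ← map_smul, ← map_add, ← map_add]
      simp
    by_cases hf : ∃ f : Q →ₗ[R] R, IsUnit (f w)
    · obtain ⟨f, hf⟩ := hf
      obtain ⟨s, hs⟩ := hf.exists_right_inv
      let S := Submodule.span R {w}
      let t : Q ⧸ S →ₗ[R] Q := S.liftQ (LinearMap.id - (s • f).smulRight w) (by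
        rw [Submodule.span_le, Set.singleton_subset_iff]
        change w - (s * f w) • w = 0
        rw [mul_comm, hs, one_smul, sub_self])
      have : Module.Projective R (Q ⧸ S) := by
        refine Module.Projective.of_split t S.mkQ ?_
        refine Submodule.linearMap_qext _ ?_
        ext q
        change S.mkQ (q - (s * f q) • w) = S.mkQ q
        rw [map_sub, sub_eq_self]
        exact (Submodule.Quotient.mk_eq_zero S).2 (S.smul_mem _ (Submodule.mem_span_singleton_self w))
      have hπw : π w = 0 := by
        rw [← LinearMap.mem_ker, hk]
        exact ⟨_, rfl⟩
      have hS : S ≤ LinearMap.ker π := by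
        rw [Submodule.span_le, Set.singleton_subset_iff]
        exact hπw
      refine ih (Q ⧸ S) V (S.mkQ ∘ₗ φ ∘ₗ c.toLinearMap ∘ₗ LinearMap.inr R R _) (S.liftQ π hS)
        ?_ ?_ ?_ hV hP
      · rw [injective_iff_map_eq_zero]
        intro u hu
        change S.mkQ (φ (c (0, u))) = 0 at hu
        rw [Submodule.mkQ_apply, Submodule.Quotient.mk_eq_zero, Submodule.mem_span_singleton] at hu
        obtain ⟨r, hr⟩ := hu
        have h0 : φ (c (-r, u)) = 0 := by
          rw [hc, ← hr]
          module
        have h1 := c.injective (hφ (h0.trans (by simp : (0 : Q) = φ (c 0))))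
        exact congrArg Prod.snd h1
      · intro y
        obtain ⟨q, rfl⟩ := hπ y
        exact ⟨S.mkQ q, rfl⟩
      · ext y
        obtain ⟨q, rfl⟩ := Submodule.Quotient.mk_surjective _ y
        rw [LinearMap.mem_ker]
        change π q = 0 ↔ _
        rw [← LinearMap.mem_ker, hk]
        constructor
        · rintro ⟨x, rfl⟩
          obtain ⟨⟨r, u⟩, rfl⟩ := c.surjective x
          refine ⟨u, ?_⟩
          change S.mkQ (φ (c (0, u))) = S.mkQ (φ (c (r, u)))
          rw [hc r u, map_add, eq_comm, add_eq_right]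
          exact (Submodule.Quotient.mk_eq_zero S).2 (S.smul_mem _ (Submodule.mem_span_singleton_self w))
        · rintro ⟨u, hu⟩
          change S.mkQ (φ (c (0, u))) = S.mkQ q at hu
          rw [Submodule.mkQ_apply, Submodule.mkQ_apply, Submodule.Quotient.eq,
            Submodule.mem_span_singleton] at hu
          obtain ⟨r, hr⟩ := hu
          refine ⟨c (-r, u), ?_⟩
          rw [hc, neg_smul, hr]
          abel
    · have : Module.Free R Q := Module.free_of_flat_of_isLocalRing
      let e : Q ≃ₗ[R] (Fin (Module.finrank R Q) → R) := (Module.finBasis R Q).equivFun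
      refine ⟨_, e w, ?_, ?_, ?_⟩
      · intro r hr
        rw [← map_smul, e.map_eq_zero_iff] at hr
        rw [← map_smul, ← map_smul, ← (by simp : φ (c 0) = 0)] at hr
        have h1 := c.injective (hφ hr)
        simpa using congrArg Prod.fst h1
      · have key := comp hX (c.toLinearMap ∘ₗ LinearMap.inl R R _) (e.toLinearMap ∘ₗ φ)
          (e.injective.comp hφ) ?_ ?_
        · have : LinearMap.range ((e.toLinearMap ∘ₗ φ) ∘ₗ (c.toLinearMap ∘ₗ LinearMap.inl R R _))
              = Submodule.span R {e w} := by
            rw [← LinearMap.range_toSpanSingleton]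
            congr 1
            ext1
            simp [w]
          rw [this] at key
          exact key
        · refine coker hX _ (LinearMap.snd R R _ ∘ₗ c.symm.toLinearMap) ?_ ?_
            (projX hX (Fin n → R))
          · exact (LinearMap.snd_surjective (R := R)).comp c.symm.surjective
          · ext x
            obtain ⟨⟨r, u⟩, rfl⟩ := c.surjective x
            simp only [LinearMap.mem_ker, LinearMap.comp_apply, LinearEquiv.coe_coe,
              LinearEquiv.symm_apply_apply, LinearMap.snd_apply, LinearMap.mem_range,
              LinearMap.inl_apply, c.injective.eq_iff, Prod.mk.injEq]
            constructor
            · rintro rfl; exact ⟨r, rfl, rfl⟩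
            · rintro ⟨_, _, rfl⟩; rfl
        · refine coker hX _ (π ∘ₗ e.symm.toLinearMap) (hπ.comp e.symm.surjective) ?_ hV
          rw [LinearMap.ker_comp, hk, LinearMap.range_comp]
          ext x
          rw [Submodule.mem_comap, Submodule.mem_map_equiv]
          rfl
      · intro j
        rw [IsLocalRing.mem_maximalIdeal, mem_nonunits_iff]
        intro hu
        exact hf ⟨LinearMap.proj j ∘ₗ e.toLinearMap, hu⟩

end ResAux

namespace ResAux

variable {R : Type} [CommRing R] {X : ModuleCat.{0} R → Prop}

theorem infinite_radius [IsNoetherianRing R] [IsLocalRing R] (hX : Resolving R X) {m : ℕ}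
    (v : Fin m → R) (hv : ∀ r : R, r • v = 0 → r = 0)
    (hXv : X (ModuleCat.of R ((Fin m → R) ⧸ Submodule.span R {v})))
    (hvm : ∀ j, v j ∈ IsLocalRing.maximalIdeal R) : ¬ FiniteRadius R X := by
  rintro ⟨C, n, hC, hball⟩
  let l := List.ofFn v
  have hl : Ideal.span {x | x ∈ l} ≠ ⊤ := by
    have : Ideal.span {x | x ∈ l} ≤ IsLocalRing.maximalIdeal R := by
      rw [Ideal.span_le]
      intro x hx
      have hx' : x ∈ List.ofFn v := hx
      rw [List.mem_ofFn] at hx'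
      obtain ⟨j, rfl⟩ := hx'
      exact hvm j
    exact ne_top_of_le_ne_top (IsLocalRing.maximalIdeal.isMaximal R).ne_top this
  obtain ⟨a, ha, hU⟩ := KSys.unif_ball (KSys.kos_bdd l) (KSys.kos_proZero l) C (hX.fg C hC) n 1
  have hrad : Ideal.span {x | x ∈ l} ≤ (Ideal.span {x | ∃ y ∈ l, y ^ a = x}).radical := by
    rw [Ideal.span_le]
    intro x hx
    exact ⟨a, Ideal.subset_span ⟨x, hx, rfl⟩⟩
  obtain ⟨k, hk⟩ := Ideal.exists_pow_le_of_le_radical_of_fg hrad (IsNoetherian.noetherian _)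
  obtain ⟨Q, w, hw, hXw, hwk⟩ := powers hX v hv hXv k
  exact KSys.not_PZ l hl a ha Q w hw (Submodule.smul_mono hk le_rfl hwk)
    (hU _ (hball _ hXw) 0)

/-- key construction -/
theorem construct (hX : Resolving R X)
    (M K N : ModuleCat.{0} R) (hM : X M)
    (hext : ¬ ExtVanish R M (ModuleCat.of R R) 1)
    (hK : IsSyzygy R K M)
    (hrefl : Function.Bijective (Module.Dual.eval R K))
    (hN : IsNthCosyzygy R 2 N K) (hNX : X N) :
    ∃ (P Q V : ModuleCat.{0} R) (φ : P →ₗ[R] Q) (π : Q →ₗ[R] V), FGProj R P ∧ FGProj R Q ∧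
      Function.Injective φ ∧ Function.Surjective π ∧ LinearMap.ker π = LinearMap.range φ ∧
      X V ∧ ¬ Module.Projective R V := by
  obtain ⟨P, f, hP, hf, ⟨e⟩⟩ := hK
  obtain ⟨K1, ⟨K0, ⟨e0⟩, P1, j0, hj0, ⟨e1⟩⟩, P2, q0, hq0, ⟨e2⟩⟩ := hN
  have := hP.2
  have := hP.1
  have := hj0.1.2
  have := hj0.1.1
  have := hq0.1.2
  have := hq0.1.1
  let i : K →ₗ[R] P := (LinearMap.ker f).subtype ∘ₗ e.toLinearMap
  have hi : Function.Injective i := Subtype.val_injective.comp e.injective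
  let j : K →ₗ[R] P1 := j0 ∘ₗ e0.symm.toLinearMap
  have hj : ∀ (Q : ModuleCat.{0} R), FGProj R Q → ∀ g : K →ₗ[R] Q,
      ∃ h : P1 →ₗ[R] Q, ∀ x, h (j x) = g x := by
    intro Q hQ g
    obtain ⟨h, hh⟩ := hj0.2 Q hQ (g ∘ₗ e0.toLinearMap)
    refine ⟨h, fun x => ?_⟩
    have := LinearMap.congr_fun hh (e0.symm x)
    rw [LinearMap.comp_apply, LinearMap.comp_apply, LinearEquiv.coe_coe,
      LinearEquiv.apply_symm_apply] at this
    exact this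
  have hR : FGProj R (ModuleCat.of R R) :=
    ⟨inferInstanceAs (Module.Finite R R), inferInstanceAs (Module.Projective R R)⟩
  have hj1 : ∀ g : K →ₗ[R] R, ∃ h : P1 →ₗ[R] R, ∀ x, h (j x) = g x :=
    hj (ModuleCat.of R R) hR
  have hrj : LinearMap.range j = LinearMap.range j0 := by
    rw [LinearMap.range_comp, LinearEquiv.range, Submodule.map_top]
  let p : P1 →ₗ[R] K1 := e1.symm.toLinearMap ∘ₗ (LinearMap.range j0).mkQ
  have hp : Function.Surjective p :=
    e1.symm.surjective.comp (Submodule.mkQ_surjective _)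
  have hpk : LinearMap.ker p = LinearMap.range j := by
    rw [LinearEquiv.ker_comp, Submodule.ker_mkQ, hrj]
  let q : P1 →ₗ[R] P2 := q0 ∘ₗ p
  have hqr : LinearMap.range q = LinearMap.range q0 :=
    LinearMap.range_comp_of_range_eq_top _ (LinearMap.range_eq_top.2 hp)
  have hqk : LinearMap.ker q = LinearMap.range j := by
    apply le_antisymm
    · intro x hx
      rw [LinearMap.mem_ker] at hx
      -- functionals vanishing on the image of `K` vanish at `x`
      have h1 : ∀ g : P1 →ₗ[R] R, (∀ y, g (j y) = 0) → g x = 0 := by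
        intro g hg
        have hle : LinearMap.range j0 ≤ LinearMap.ker g := by
          rw [← hrj]
          rintro _ ⟨y, rfl⟩
          exact hg y
        let g' : K1 →ₗ[R] R := (LinearMap.range j0).liftQ g hle ∘ₗ e1.toLinearMap
        obtain ⟨h, hh⟩ := hq0.2 (ModuleCat.of R R) hR g'
        have h2 : g' (p x) = g x := by
          simp [g', p]
        rw [← h2, ← LinearMap.congr_fun hh (p x)]
        change h (q x) = 0
        rw [hx, map_zero]
      choose s hs using hj1
      have hs' : ∀ (g : K →ₗ[R] R) (h : P1 →ₗ[R] R), (∀ y, h (j y) = g y) → s g x = h x := by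
        intro g h hh
        rw [← sub_eq_zero]
        exact h1 (s g - h) fun y => by simp [hs, hh]
      let ξ : Module.Dual R (Module.Dual R K) :=
        { toFun := fun g => s g x
          map_add' := fun g g' => hs' _ (s g + s g') fun y => by simp [hs]
          map_smul' := fun r g => hs' _ (r • s g) fun y => by simp [hs] }
      obtain ⟨y, hy⟩ := hrefl.2 ξ
      refine ⟨y, ?_⟩
      rw [← sub_eq_zero, ← Module.forall_dual_apply_eq_zero_iff R]
      intro g
      rw [map_sub, sub_eq_zero]
      have h3 := LinearMap.congr_fun hy (g ∘ₗ j)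
      change g (j y) = s (g ∘ₗ j) x at h3
      rw [h3]
      exact hs' _ g fun y => rfl
    · rw [← hpk]
      exact LinearMap.ker_le_ker_comp _ _
  obtain ⟨h, hh⟩ := hj P hP i
  let φ : P1 →ₗ[R] (P × P2) := h.prod q
  have hφ : Function.Injective φ := by
    rw [injective_iff_map_eq_zero]
    intro x hx
    have hx1 : h x = 0 := congrArg Prod.fst hx
    have hx2 : q x = 0 := congrArg Prod.snd hx
    rw [← LinearMap.mem_ker, hqk] at hx2
    obtain ⟨y, rfl⟩ := hx2
    rw [hh] at hx1
    rw [hi (hx1.trans (map_zero i).symm), map_zero]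
  let S := LinearMap.range φ
  refine ⟨P1, ModuleCat.of R (P × P2), ModuleCat.of R ((P × P2) ⧸ S), φ, S.mkQ, hj0.1,
    ⟨inferInstanceAs (Module.Finite R (P × P2)), inferInstanceAs (Module.Projective R (P × P2))⟩,
    hφ, Submodule.mkQ_surjective _, Submodule.ker_mkQ _, ?_, ?_⟩
  · have hle : LinearMap.ker f ≤ LinearMap.ker (S.mkQ ∘ₗ LinearMap.inl R P P2) := by
      intro x hx
      obtain ⟨y, hy⟩ := e.surjective ⟨x, hx⟩
      have hxy : i y = x := congrArg Subtype.val hy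
      rw [LinearMap.mem_ker, LinearMap.comp_apply, Submodule.mkQ_apply,
        Submodule.Quotient.mk_eq_zero]
      refine ⟨j y, ?_⟩
      have : q (j y) = 0 := by
        rw [← LinearMap.mem_ker, hqk]
        exact ⟨y, rfl⟩
      change (h (j y), q (j y)) = (x, 0)
      rw [this, hh, hxy]
    have hle2 : S ≤ LinearMap.ker ((LinearMap.range q).mkQ ∘ₗ LinearMap.snd R P P2) := by
      rintro _ ⟨x, rfl⟩
      rw [LinearMap.mem_ker, LinearMap.comp_apply, Submodule.mkQ_apply,
        Submodule.Quotient.mk_eq_zero]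
      exact ⟨x, rfl⟩
    refine ext3 hX ((LinearMap.ker f).liftQ _ hle) (S.liftQ _ hle2) ?_ ?_ ?_
      (iso hX (f.quotKerEquivOfSurjective hf).symm hM)
      (iso hX (e2.trans (Submodule.quotEquivOfEq _ _ hqr.symm)) hNX)
    · rw [injective_iff_map_eq_zero]
      intro y
      obtain ⟨x, rfl⟩ := Submodule.Quotient.mk_surjective _ y
      intro hx
      change (Submodule.Quotient.mk ((x, 0) : P × P2) : (P × P2) ⧸ S) = 0 at hx
      rw [Submodule.Quotient.mk_eq_zero] at hx
      obtain ⟨z, hz⟩ := hx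
      have hz1 : h z = x := congrArg Prod.fst hz
      have hz2 : q z = 0 := congrArg Prod.snd hz
      rw [← LinearMap.mem_ker, hqk] at hz2
      obtain ⟨k, rfl⟩ := hz2
      rw [Submodule.Quotient.mk_eq_zero, ← hz1, hh]
      exact (e k).2
    · intro y
      obtain ⟨x, rfl⟩ := Submodule.Quotient.mk_surjective _ y
      exact ⟨Submodule.Quotient.mk (0, x), rfl⟩
    · ext y
      obtain ⟨⟨x1, x2⟩, rfl⟩ := Submodule.Quotient.mk_surjective _ y
      rw [LinearMap.mem_ker]
      change (Submodule.Quotient.mk x2 : P2 ⧸ LinearMap.range q) = 0 ↔ _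
      rw [Submodule.Quotient.mk_eq_zero]
      constructor
      · rintro ⟨z, rfl⟩
        refine ⟨Submodule.Quotient.mk (x1 - h z), ?_⟩
        change (Submodule.Quotient.mk ((x1 - h z, 0) : P × P2) : (P × P2) ⧸ S) = _
        rw [Submodule.Quotient.eq]
        refine ⟨-z, ?_⟩
        change (h (-z), q (-z)) = _
        ext <;> simp
      · rintro ⟨y, hy⟩
        obtain ⟨x, rfl⟩ := Submodule.Quotient.mk_surjective _ y
        change (Submodule.Quotient.mk ((x, 0) : P × P2) : (P × P2) ⧸ S) = _ at hy
        rw [Submodule.Quotient.eq] at hy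
        obtain ⟨z, hz⟩ := hy
        have hz2 : q z = 0 - x2 := congrArg Prod.snd hz
        exact ⟨-z, by rw [map_neg, hz2]; simp⟩
  · intro hV
    have hV' : Module.Projective R ((P × P2) ⧸ S) := hV
    apply hext
    refine ext_vanish_aux R M P f hf fun g => ?_
    obtain ⟨t, ht⟩ := Module.projective_lifting_property S.mkQ LinearMap.id
      (Submodule.mkQ_surjective _)
    -- retraction of φ
    have hret : ∀ x : P × P2, x - t (S.mkQ x) ∈ S := by
      intro x
      rw [← Submodule.Quotient.mk_eq_zero, ← Submodule.mkQ_apply, map_sub, sub_eq_zero]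
      exact (LinearMap.congr_fun ht (S.mkQ x)).symm
    let φe : P1 ≃ₗ[R] S := LinearEquiv.ofInjective φ hφ
    let ret : (P × P2) →ₗ[R] P1 := φe.symm.toLinearMap ∘ₗ
      LinearMap.codRestrict S (LinearMap.id - t ∘ₗ S.mkQ) hret
    have hrφ : ∀ x, ret (φ x) = x := by
      intro x
      change φe.symm _ = x
      rw [LinearEquiv.symm_apply_eq]
      apply Subtype.ext
      change φ x - t (S.mkQ (φ x)) = φ x
      have : S.mkQ (φ x) = 0 := (Submodule.Quotient.mk_eq_zero S).2 ⟨x, rfl⟩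
      rw [this, map_zero, sub_zero]
    obtain ⟨g', hg'⟩ := hj1 (g ∘ₗ e.toLinearMap)
    refine ⟨g' ∘ₗ ret ∘ₗ LinearMap.inl R P P2, fun x => ?_⟩
    obtain ⟨y, rfl⟩ := e.surjective x
    have hφj : φ (j y) = (i y, 0) := by
      have : q (j y) = 0 := by
        rw [← LinearMap.mem_ker, hqk]
        exact ⟨y, rfl⟩
      change (h (j y), q (j y)) = _
      rw [this, hh]
    change g' (ret (i y, 0)) = _
    rw [← hφj, hrφ, hg']
    rfl

end ResAux

/-- if `X` contains `M` with `Ext^1(M,R) ≠ 0`, `ΩM` reflexive and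
`Ω⁻²ΩM ∈ X`, then `X` contains a nonfree module of finite projective dimension and
has infinite radius. -/
theorem stmt10 (R : Type) [CommRing R] [IsNoetherianRing R] [IsLocalRing R]
    (X : ModuleCat.{0} R → Prop) (hX : Resolving R X)
    (M K N : ModuleCat.{0} R) (hM : X M)
    (hext : ¬ ExtVanish R M (ModuleCat.of R R) 1)
    (hK : IsSyzygy R K M)
    (hrefl : Function.Bijective (Module.Dual.eval R K))
    (hN : IsNthCosyzygy R 2 N K) (hNX : X N) :
    (∃ W, X W ∧ FiniteProjDim R W ∧ ¬ Module.Free R W) ∧ ¬ FiniteRadius R X := by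
  obtain ⟨P, Q, V, φ, π, hP, hQ, hφ, hπ, hk, hV, hproj⟩ :=
    ResAux.construct hX M K N hM hext hK hrefl hN hNX
  have := hP.1
  have := hP.2
  have := hQ.1
  have := hQ.2
  refine ⟨⟨V, hV, ⟨1, P, ⟨V, ⟨LinearEquiv.refl R V⟩, Q, π, hQ, hπ, ⟨?_⟩⟩, hP⟩, ?_⟩, ?_⟩
  · exact (LinearEquiv.ofInjective φ hφ).trans (LinearEquiv.ofEq _ _ hk.symm)
  · intro hfree
    exact hproj inferInstance
  · have : Module.Free R P := Module.free_of_flat_of_isLocalRing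
    let e : P ≃ₗ[R] (Fin (Module.finrank R P) → R) := (Module.finBasis R P).equivFun
    obtain ⟨m, v, hv, hXv, hvm⟩ := ResAux.rank_one hX (Module.finrank R P) Q V
      (φ ∘ₗ e.symm.toLinearMap) π (hφ.comp e.symm.injective) hπ
      (by rw [hk, LinearMap.range_comp, LinearEquiv.range, Submodule.map_top]) hV hproj
    exact ResAux.infinite_radius hX v hv hXv hvm
end
end
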